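/- arXiv:2202.07821 — 2 statements merged into one kernel-verified Lean document; each statement's English description precedes it below -/
import Mathlib

section
/- (Complexity bound with Polyak step sizes.) Let f : S⁺_n → ℝ be geodesically convex, let X ⊆ S⁺_n be a nonempty compact geodesically convex set with diam(X) ≤ D for some D > 0, and let f* := inf_{p ∈ X} f(p). Set κ̂ = 1/√2. Fix ε > 0 and 0 < α < 2·tanh(κ̂D)/(κ̂D), and let {p_k} be generated by the inexact projected subgradient iteration with p₀ ∈ X, v_k = s_k + u_k ≠ 0, s_k ∈ ∂f(p_k), and Polyak step sizes t_k = α·( f(p_k) − f* − εD )/‖v_k‖_{p_k}. Let ι > 0 and N ∈ ℕ, and define Γ := ( 2α − (κ̂D/tanh(κ̂D))·α² )/( (ε + ι)²·D² ). If ‖u_k‖_{p_k} ≤ ε, ‖s_k‖_{p_k} ≤ ι and t_k ≥ 0 for all k ∈ {0,1,…,N−1}, then min{ f(p_k) − (f* + εD) : k = 0,1,…,N−1 } ≤ 1/(√Γ·√N). -/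
open Matrix Real Filter

namespace SPD

variable {n : ℕ}

/-- Apply a real function to a symmetric matrix via the spectral calculus
(junk value `0` on non-Hermitian input). -/
noncomputable def mfun (p : Matrix (Fin n) (Fin n) ℝ) (f : ℝ → ℝ) : Matrix (Fin n) (Fin n) ℝ :=
  if hp : p.IsHermitian then hp.cfc f else 0

/-- The positive definite square root. -/
noncomputable def msqrt (p : Matrix (Fin n) (Fin n) ℝ) : Matrix (Fin n) (Fin n) ℝ :=
  mfun p Real.sqrt

/-- The eigenvalues of a symmetric matrix (junk value `0` on non-Hermitian input). -/
noncomputable def eigs (p : Matrix (Fin n) (Fin n) ℝ) : Fin n → ℝ :=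
  if hp : p.IsHermitian then hp.eigenvalues else 0

/-- The Loewner order: `p ≤ q` iff `q - p` is positive semidefinite. -/
def Loewner (p q : Matrix (Fin n) (Fin n) ℝ) : Prop := (q - p).PosSemidef

/-- The Riemannian (trace-metric) distance on positive definite matrices:
`d(p,q) = (∑ i, (ln λ_i(p^{-1/2} q p^{-1/2}))²)^{1/2}`. -/
noncomputable def dR (p q : Matrix (Fin n) (Fin n) ℝ) : ℝ :=
  Real.sqrt (∑ i, (Real.log (eigs ((msqrt p)⁻¹ * q * (msqrt p)⁻¹) i)) ^ 2)

/-- The θ-weighted geometric mean `p #_θ q = p^{1/2} (p^{-1/2} q p^{-1/2})^θ p^{1/2}`. -/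
noncomputable def gmean (θ : ℝ) (p q : Matrix (Fin n) (Fin n) ℝ) : Matrix (Fin n) (Fin n) ℝ :=
  msqrt p * mfun ((msqrt p)⁻¹ * q * (msqrt p)⁻¹) (fun x => x ^ θ) * msqrt p

/-- The singular values of a matrix in decreasing order: `svals M i` is `α_{i+1}(M)`,
so `svals M ⟨0,_⟩ = α₁(M) ≥ … ≥ svals M ⟨n-1,_⟩ = α_n(M)`. -/
noncomputable def svals (M : Matrix (Fin n) (Fin n) ℝ) : Fin n → ℝ := fun i =>
  Real.sqrt ((eigs (Mᵀ * M) ∘ Tuple.sort (eigs (Mᵀ * M))) i.rev)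

/-- The operator (spectral) norm: the largest singular value. -/
noncomputable def opNorm (M : Matrix (Fin n) (Fin n) ℝ) : ℝ :=
  if h : 0 < n then svals M ⟨0, h⟩ else 0

/-- The trace-metric inner product `⟨u,v⟩_p = tr(p⁻¹ u p⁻¹ v)`. -/
noncomputable def minner (p u v : Matrix (Fin n) (Fin n) ℝ) : ℝ :=
  (p⁻¹ * u * p⁻¹ * v).trace

/-- The trace-metric norm `‖v‖_p`. -/
noncomputable def mnorm (p v : Matrix (Fin n) (Fin n) ℝ) : ℝ :=
  Real.sqrt (minner p v v)

/-- The Riemannian exponential `exp_p(v) = p^{1/2} exp(p^{-1/2} v p^{-1/2}) p^{1/2}`. -/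
noncomputable def mexpP (p v : Matrix (Fin n) (Fin n) ℝ) : Matrix (Fin n) (Fin n) ℝ :=
  msqrt p * mfun ((msqrt p)⁻¹ * v * (msqrt p)⁻¹) Real.exp * msqrt p

/-- The Riemannian logarithm `log_p(q) = p^{1/2} log(p^{-1/2} q p^{-1/2}) p^{1/2}`. -/
noncomputable def mlogP (p q : Matrix (Fin n) (Fin n) ℝ) : Matrix (Fin n) (Fin n) ℝ :=
  msqrt p * mfun ((msqrt p)⁻¹ * q * (msqrt p)⁻¹) Real.log * msqrt p

/-- `s` is a subgradient of `f` at `p`:  `f(q) ≥ f(p) + ⟨s, log_p q⟩_p` for all `q ∈ S⁺_n`. -/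
def IsSubgrad (f : Matrix (Fin n) (Fin n) ℝ → ℝ) (p s : Matrix (Fin n) (Fin n) ℝ) : Prop :=
  s.IsHermitian ∧ ∀ q : Matrix (Fin n) (Fin n) ℝ, q.PosDef → f p + minner p s (mlogP p q) ≤ f q

/-- Geodesic convexity of a function on `S⁺_n`. -/
def GConvexFun (f : Matrix (Fin n) (Fin n) ℝ → ℝ) : Prop :=
  ∀ p q : Matrix (Fin n) (Fin n) ℝ, p.PosDef → q.PosDef → ∀ θ ∈ Set.Icc (0:ℝ) 1,
    f (gmean θ p q) ≤ (1 - θ) * f p + θ * f q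

/-- Geodesic convexity of a subset of `S⁺_n`. -/
def GConvexSet (X : Set (Matrix (Fin n) (Fin n) ℝ)) : Prop :=
  ∀ p ∈ X, ∀ q ∈ X, ∀ θ ∈ Set.Icc (0:ℝ) 1, gmean θ p q ∈ X

/-- `κ̂ = 1/√2`, the square root of the absolute value of the curvature lower bound `-1/2`. -/
noncomputable def khat : ℝ := (Real.sqrt 2)⁻¹

/-- The inexact projected subgradient iteration: `p₀ ∈ X`; `v_k = s_k + u_k ≠ 0` with
`s_k ∈ ∂f(p_k)` and symmetric error `u_k`; `p̃_{k+1} = exp_{p_k}(−t_k·v_k/‖v_k‖_{p_k})`;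
and `p_{k+1} ∈ X` is a nearest point of `X` to `p̃_{k+1}` w.r.t. `d`. -/
structure Iter (f : Matrix (Fin n) (Fin n) ℝ → ℝ) (X : Set (Matrix (Fin n) (Fin n) ℝ))
    (p s u : ℕ → Matrix (Fin n) (Fin n) ℝ) (t : ℕ → ℝ) : Prop where
  p0_mem : p 0 ∈ X
  subgrad : ∀ k, IsSubgrad f (p k) (s k)
  u_herm : ∀ k, (u k).IsHermitian
  v_ne : ∀ k, s k + u k ≠ 0
  proj_mem : ∀ k, p (k + 1) ∈ X
  proj_nearest : ∀ k, ∀ q ∈ X,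
    dR (mexpP (p k) (-(t k / mnorm (p k) (s k + u k)) • (s k + u k))) (p (k + 1)) ≤
      dR (mexpP (p k) (-(t k / mnorm (p k) (s k + u k)) • (s k + u k))) q

end SPD

namespace SPDAux
section
open SPD
open scoped Matrix.Norms.Frobenius

variable {n : ℕ}

theorem norm_sq_trace (M : Matrix (Fin n) (Fin n) ℝ) : ‖M‖ ^ 2 = (Mᵀ * M).trace := by
  rw [frobenius_norm_def, ← Real.sqrt_eq_rpow, Real.sq_sqrt (by positivity)]
  simp only [Matrix.trace, Matrix.diag, Matrix.mul_apply, Matrix.transpose_apply]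
  rw [Finset.sum_comm]
  simp [sq]

theorem norm_sq_sum (M : Matrix (Fin n) (Fin n) ℝ) : ‖M‖ ^ 2 = ∑ i, ∑ j, M i j ^ 2 := by
  rw [frobenius_norm_def, ← Real.sqrt_eq_rpow, Real.sq_sqrt (by positivity)]
  simp

/-- orthogonal matrices -/
def Orth (U : Matrix (Fin n) (Fin n) ℝ) : Prop := Uᵀ * U = 1 ∧ U * Uᵀ = 1

theorem Orth.transpose {U : Matrix (Fin n) (Fin n) ℝ} (h : Orth U) : Orth Uᵀ :=
  ⟨by simpa using h.2, by simpa using h.1⟩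

theorem Orth.mul {U V : Matrix (Fin n) (Fin n) ℝ} (h : Orth U) (k : Orth V) : Orth (U * V) := by
  constructor
  · rw [transpose_mul, Matrix.mul_assoc, ← Matrix.mul_assoc Uᵀ, h.1, Matrix.one_mul, k.1]
  · rw [transpose_mul, Matrix.mul_assoc, ← Matrix.mul_assoc V, k.2, Matrix.one_mul, h.2]

theorem Orth.norm_left {U : Matrix (Fin n) (Fin n) ℝ} (h : Orth U) (M) : ‖U * M‖ = ‖M‖ := by
  have : ‖U * M‖ ^ 2 = ‖M‖ ^ 2 := by
    rw [norm_sq_trace, norm_sq_trace, transpose_mul, Matrix.mul_assoc, ← Matrix.mul_assoc Uᵀ,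
      h.1, Matrix.one_mul]
  exact (sq_eq_sq₀ (norm_nonneg _) (norm_nonneg _)).1 this

theorem Orth.norm_right {U : Matrix (Fin n) (Fin n) ℝ} (h : Orth U) (M) : ‖M * U‖ = ‖M‖ := by
  rw [← frobenius_norm_transpose, transpose_mul, h.transpose.norm_left, frobenius_norm_transpose]

theorem isHermitian_iff_transpose {A : Matrix (Fin n) (Fin n) ℝ} : A.IsHermitian ↔ Aᵀ = A := by
  rw [Matrix.IsHermitian, conjTranspose_eq_transpose_of_trivial]

theorem herm_conj (K : Matrix (Fin n) (Fin n) ℝ) {A : Matrix (Fin n) (Fin n) ℝ}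
    (hA : A.IsHermitian) : (K * A * Kᵀ).IsHermitian := by
  rw [isHermitian_iff_transpose] at *
  simp [transpose_mul, hA, Matrix.mul_assoc]

theorem spec {A : Matrix (Fin n) (Fin n) ℝ} (hA : A.IsHermitian) :
    ∃ (U : Matrix (Fin n) (Fin n) ℝ) (l : Fin n → ℝ), Orth U ∧ A = U * diagonal l * Uᵀ ∧
      eigs A = l ∧ ∀ f : ℝ → ℝ, mfun A f = U * diagonal (f ∘ l) * Uᵀ := by
  refine ⟨hA.eigenvectorUnitary, hA.eigenvalues, ⟨?_, ?_⟩, ?_, ?_, ?_⟩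
  · rw [← conjTranspose_eq_transpose_of_trivial, ← star_eq_conjTranspose]
    exact Unitary.coe_star_mul_self _
  · rw [← conjTranspose_eq_transpose_of_trivial, ← star_eq_conjTranspose]
    exact Unitary.coe_mul_star_self _
  · conv_lhs => rw [hA.spectral_theorem]
    rw [Unitary.conjStarAlgAut_apply, ← conjTranspose_eq_transpose_of_trivial,
      ← star_eq_conjTranspose]
    rfl
  · exact dif_pos hA
  · intro f
    simp only [mfun, hA, dite_true, IsHermitian.cfc]
    rw [Unitary.conjStarAlgAut_apply, ← conjTranspose_eq_transpose_of_trivial,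
      ← star_eq_conjTranspose]
    rfl

theorem herm_of_spec (U : Matrix (Fin n) (Fin n) ℝ) (l : Fin n → ℝ) :
    (U * diagonal l * Uᵀ).IsHermitian :=
  herm_conj U (isHermitian_iff_transpose.2 (by simp))

theorem Orth.conj_eq {U V A B : Matrix (Fin n) (Fin n) ℝ} (hU : Orth U) (hV : Orth V)
    (h : U * A * Uᵀ = V * B * Vᵀ) : A * (Uᵀ * V) = (Uᵀ * V) * B := by
  have h2 := congrArg (fun M => Uᵀ * M * V) h
  have e1 : Uᵀ * (U * A * Uᵀ) * V = A * (Uᵀ * V) := by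
    rw [← Matrix.mul_assoc, ← Matrix.mul_assoc, hU.1, Matrix.one_mul, Matrix.mul_assoc]
  have e2 : Uᵀ * (V * B * Vᵀ) * V = (Uᵀ * V) * B := by
    simp only [Matrix.mul_assoc]
    rw [hV.1, Matrix.mul_one]
  rw [e1, e2] at h2
  exact h2

theorem Orth.conj_eq' {U V A B : Matrix (Fin n) (Fin n) ℝ} (hU : Orth U) (hV : Orth V)
    (h : A * (Uᵀ * V) = (Uᵀ * V) * B) : U * A * Uᵀ = V * B * Vᵀ := by
  have h2 := congrArg (fun M => U * M * Vᵀ) h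
  have e1 : U * (A * (Uᵀ * V)) * Vᵀ = U * A * Uᵀ := by
    simp only [Matrix.mul_assoc]
    rw [hV.2, Matrix.mul_one]
  have e2 : U * ((Uᵀ * V) * B) * Vᵀ = V * B * Vᵀ := by
    simp only [← Matrix.mul_assoc]
    rw [hU.2, Matrix.one_mul]
  rw [e1, e2] at h2
  exact h2

theorem mfun_conj {U : Matrix (Fin n) (Fin n) ℝ} (hU : Orth U) (m : Fin n → ℝ) (f : ℝ → ℝ) :
    mfun (U * diagonal m * Uᵀ) f = U * diagonal (f ∘ m) * Uᵀ := by
  obtain ⟨V, l, hV, h1, -, h3⟩ := spec (herm_of_spec U m)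
  rw [h3]
  have := hV.conj_eq hU h1.symm
  refine hV.conj_eq' hU ?_
  ext i j
  have h := congrFun (congrFun this i) j
  rw [diagonal_mul, mul_diagonal] at h ⊢
  by_cases hw : (Vᵀ * U) i j = 0
  · simp [hw]
  · have : l i = m j := by
      apply mul_right_cancel₀ hw; rw [h, mul_comm]
    simp [this, mul_comm]

/-- matrix logarithm -/
noncomputable def lg (M : Matrix (Fin n) (Fin n) ℝ) : Matrix (Fin n) (Fin n) ℝ := mfun M Real.log

theorem Orth.isUnit {U : Matrix (Fin n) (Fin n) ℝ} (h : Orth U) : IsUnit U :=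
  ⟨⟨U, Uᵀ, h.2, h.1⟩, rfl⟩

theorem Orth.inv {U : Matrix (Fin n) (Fin n) ℝ} (h : Orth U) : U⁻¹ = Uᵀ :=
  Matrix.inv_eq_right_inv h.2

theorem exp_spec {U : Matrix (Fin n) (Fin n) ℝ} (hU : Orth U) (l : Fin n → ℝ) :
    NormedSpace.exp (U * diagonal l * Uᵀ) = U * diagonal (Real.exp ∘ l) * Uᵀ := by
  rw [← hU.inv, Matrix.exp_conj _ _ hU.isUnit, Matrix.exp_diagonal]
  congr 3
  ext i
  rw [Pi.exp_def]
  simp [Real.exp_eq_exp_ℝ]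

theorem mfun_exp {A : Matrix (Fin n) (Fin n) ℝ} (hA : A.IsHermitian) :
    mfun A Real.exp = NormedSpace.exp A := by
  obtain ⟨U, l, hU, h1, -, h3⟩ := spec hA
  rw [h3, h1, exp_spec hU]

theorem posDef_spec {U : Matrix (Fin n) (Fin n) ℝ} (hU : Orth U) {l : Fin n → ℝ}
    (hl : ∀ i, 0 < l i) : (U * diagonal l * Uᵀ).PosDef := by
  have := (PosDef.diagonal hl).mul_mul_conjTranspose_same (B := U)
    (by
      intro x y hxy
      have := congrArg (fun z => z ᵥ* Uᵀ) hxy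
      simpa [Matrix.vecMul_vecMul, hU.2] using this)
  rwa [conjTranspose_eq_transpose_of_trivial] at this

theorem spec_pos {A : Matrix (Fin n) (Fin n) ℝ} (hA : A.PosDef) :
    ∃ (U : Matrix (Fin n) (Fin n) ℝ) (l : Fin n → ℝ), Orth U ∧ (∀ i, 0 < l i) ∧
      A = U * diagonal l * Uᵀ ∧
      eigs A = l ∧ ∀ f : ℝ → ℝ, mfun A f = U * diagonal (f ∘ l) * Uᵀ := by
  obtain ⟨U, l, hU, h1, h2, h3⟩ := spec hA.isHermitian
  refine ⟨U, l, hU, ?_, h1, h2, h3⟩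
  intro i
  rw [← h2]
  simp only [eigs, hA.isHermitian, dite_true]
  exact hA.eigenvalues_pos i

theorem posDef_exp {A : Matrix (Fin n) (Fin n) ℝ} (hA : A.IsHermitian) :
    (NormedSpace.exp A).PosDef := by
  obtain ⟨U, l, hU, h1, -, h3⟩ := spec hA
  rw [h1, exp_spec hU]
  exact posDef_spec hU (fun i => Real.exp_pos _)

theorem lg_exp {A : Matrix (Fin n) (Fin n) ℝ} (hA : A.IsHermitian) :
    lg (NormedSpace.exp A) = A := by
  obtain ⟨U, l, hU, h1, -, h3⟩ := spec hA
  rw [h1, exp_spec hU, lg, mfun_conj hU]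
  congr 3
  ext i
  simp

theorem lg_herm {M : Matrix (Fin n) (Fin n) ℝ} (hM : M.PosDef) : (lg M).IsHermitian := by
  obtain ⟨U, l, hU, -, h1, -, h3⟩ := spec_pos hM
  rw [lg, h3]
  exact herm_of_spec _ _

theorem exp_lg {M : Matrix (Fin n) (Fin n) ℝ} (hM : M.PosDef) :
    NormedSpace.exp (lg M) = M := by
  obtain ⟨U, l, hU, hl, h1, -, h3⟩ := spec_pos hM
  rw [lg, h3, exp_spec hU]
  conv_rhs => rw [h1]
  congr 3
  ext i
  simp [Real.exp_log (hl i)]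

theorem mfun_rpow {M : Matrix (Fin n) (Fin n) ℝ} (hM : M.PosDef) (θ : ℝ) :
    mfun M (fun x => x ^ θ) = NormedSpace.exp (θ • lg M) := by
  obtain ⟨U, l, hU, hl, h1, -, h3⟩ := spec_pos hM
  rw [lg, h3, h3]
  have : θ • (U * diagonal (Real.log ∘ l) * Uᵀ) = U * diagonal (θ • (Real.log ∘ l)) * Uᵀ := by
    rw [diagonal_smul, Matrix.mul_smul, Matrix.smul_mul]
  rw [this, exp_spec hU]
  congr 3
  ext i
  simp [Real.rpow_def_of_pos (hl i), mul_comm]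

theorem norm_sq_spec {U : Matrix (Fin n) (Fin n) ℝ} (hU : Orth U) (l : Fin n → ℝ) :
    ‖U * diagonal l * Uᵀ‖ ^ 2 = ∑ i, l i ^ 2 := by
  rw [hU.transpose.norm_right, hU.norm_left, norm_sq_trace]
  simp [Matrix.trace, sq]

theorem norm_lg {M : Matrix (Fin n) (Fin n) ℝ} (hM : M.PosDef) :
    Real.sqrt (∑ i, (Real.log (eigs M i)) ^ 2) = ‖lg M‖ := by
  obtain ⟨U, l, hU, hl, h1, h2, h3⟩ := spec_pos hM
  rw [h2, lg, h3, ← Real.sqrt_sq (norm_nonneg _), norm_sq_spec hU]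
  simp

theorem msqrt_props {p : Matrix (Fin n) (Fin n) ℝ} (hp : p.PosDef) :
    (msqrt p).PosDef ∧ msqrt p * msqrt p = p := by
  obtain ⟨U, l, hU, hl, h1, h2, h3⟩ := spec_pos hp
  rw [msqrt, h3]
  refine ⟨posDef_spec hU (fun i => Real.sqrt_pos.2 (hl i)), ?_⟩
  have : U * diagonal (Real.sqrt ∘ l) * Uᵀ * (U * diagonal (Real.sqrt ∘ l) * Uᵀ)
      = U * (diagonal (Real.sqrt ∘ l) * (Uᵀ * U) * diagonal (Real.sqrt ∘ l)) * Uᵀ := by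
    simp only [Matrix.mul_assoc]
  rw [this, hU.1, Matrix.mul_one, diagonal_mul_diagonal]
  conv_rhs => rw [h1]
  congr 3
  ext i
  simp [Real.mul_self_sqrt (hl i).le]

theorem posDef_conj {p K : Matrix (Fin n) (Fin n) ℝ} (hp : p.PosDef) (hK : IsUnit K) :
    (K * p * Kᵀ).PosDef := by
  have := hp.mul_mul_conjTranspose_same (B := K)
    (Matrix.vecMul_injective_of_isUnit hK)
  rwa [conjTranspose_eq_transpose_of_trivial] at this

theorem isUnit_of_posDef {p : Matrix (Fin n) (Fin n) ℝ} (hp : p.PosDef) : IsUnit p := hp.isUnit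

theorem dR_eq {p q : Matrix (Fin n) (Fin n) ℝ} (hp : p.PosDef) (hq : q.PosDef) :
    dR p q = ‖lg ((msqrt p)⁻¹ * q * (msqrt p)⁻¹)‖ := by
  rw [dR, norm_lg]
  obtain ⟨h1, -⟩ := msqrt_props hp
  have h2 := posDef_conj hq (K := (msqrt p)⁻¹) ((Matrix.isUnit_nonsing_inv_iff).2 h1.isUnit)
  rwa [isHermitian_iff_transpose.1 h1.isHermitian.inv] at h2

theorem lg_orth {U M : Matrix (Fin n) (Fin n) ℝ} (hU : Orth U) (hM : M.PosDef) :
    lg (U * M * Uᵀ) = U * lg M * Uᵀ := by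
  obtain ⟨V, l, hV, hl, h1, h2, h3⟩ := spec_pos hM
  have e : ∀ d, U * (V * diagonal d * Vᵀ) * Uᵀ = (U * V) * diagonal d * (U * V)ᵀ := by
    intro d; simp only [transpose_mul, Matrix.mul_assoc]
  conv_lhs => rw [h1]
  rw [lg, lg, h3, e, e, mfun_conj (hU.mul hV)]

theorem dR_factor {K q : Matrix (Fin n) (Fin n) ℝ} (hK : IsUnit K) (hq : q.PosDef) :
    dR (K * Kᵀ) (K * q * Kᵀ) = ‖lg q‖ := by
  have hp : (K * Kᵀ).PosDef := by simpa using posDef_conj PosDef.one hK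
  rw [dR_eq hp (posDef_conj hq hK)]
  obtain ⟨h1, h2⟩ := msqrt_props hp
  set G := msqrt (K * Kᵀ)
  have hG : IsUnit G.det := (Matrix.isUnit_iff_isUnit_det _).1 h1.isUnit
  have hGt : G⁻¹ᵀ = G⁻¹ := isHermitian_iff_transpose.1 h1.isHermitian.inv
  have ht : (G⁻¹ * K)ᵀ = Kᵀ * G⁻¹ := by rw [transpose_mul, hGt]
  have h4 : (G⁻¹ * K) * (G⁻¹ * K)ᵀ = 1 := by
    rw [ht]
    have : G⁻¹ * K * (Kᵀ * G⁻¹) = G⁻¹ * (K * Kᵀ) * G⁻¹ := by simp only [Matrix.mul_assoc]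
    rw [this, ← h2, ← Matrix.mul_assoc, Matrix.nonsing_inv_mul _ hG, Matrix.one_mul,
      Matrix.mul_nonsing_inv _ hG]
  have hO : Orth (G⁻¹ * K) := ⟨mul_eq_one_comm.1 h4, h4⟩
  have : G⁻¹ * (K * q * Kᵀ) * G⁻¹ = (G⁻¹ * K) * q * (G⁻¹ * K)ᵀ := by
    rw [ht]; simp only [Matrix.mul_assoc]
  rw [this, lg_orth hO hq, hO.transpose.norm_right, hO.norm_left]

end
end SPDAux

namespace SPDAux
section
open SPD
open scoped Matrix.Norms.Frobenius

variable {n : ℕ}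

theorem mixed_norm {U V : Matrix (Fin n) (Fin n) ℝ} (hU : Orth U) (hV : Orth V)
    (l m : Fin n → ℝ) :
    ‖V * diagonal m * Vᵀ - U * diagonal l * Uᵀ‖ ^ 2
      = ∑ i, ∑ j, (m j - l i) ^ 2 * (Uᵀ * V) i j ^ 2 := by
  rw [← hU.transpose.norm_left, ← hV.norm_right]
  have : Uᵀ * (V * diagonal m * Vᵀ - U * diagonal l * Uᵀ) * V
      = (Uᵀ * V) * diagonal m - diagonal l * (Uᵀ * V) := by
    have e1 : Uᵀ * (V * diagonal m * Vᵀ) * V = (Uᵀ * V) * diagonal m := by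
      simp only [Matrix.mul_assoc]
      rw [hV.1, Matrix.mul_one]
    have e2 : Uᵀ * (U * diagonal l * Uᵀ) * V = diagonal l * (Uᵀ * V) := by
      simp only [← Matrix.mul_assoc]
      rw [hU.1, Matrix.one_mul]
    rw [Matrix.mul_sub, Matrix.sub_mul, e1, e2]
  rw [this, norm_sq_sum]
  refine Finset.sum_congr rfl fun i _ => Finset.sum_congr rfl fun j _ => ?_
  rw [Matrix.sub_apply, mul_diagonal, diagonal_mul]
  ring

theorem mixed_trace {U V : Matrix (Fin n) (Fin n) ℝ} (l m : Fin n → ℝ) :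
    ((V * diagonal m * Vᵀ) * (U * diagonal l * Uᵀ)).trace
      = ∑ i, ∑ j, (m j * l i) * (Uᵀ * V) i j ^ 2 := by
  have : ((V * diagonal m * Vᵀ) * (U * diagonal l * Uᵀ)).trace
      = ((diagonal m * (Uᵀ * V)ᵀ) * (diagonal l * (Uᵀ * V))).trace := by
    rw [Matrix.mul_assoc V, Matrix.mul_assoc V, Matrix.trace_mul_comm]
    simp only [transpose_mul, transpose_transpose, Matrix.mul_assoc]
  rw [this, Matrix.trace, Finset.sum_comm]
  refine Finset.sum_congr rfl fun i _ => ?_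
  rw [Matrix.diag, Matrix.mul_apply]
  refine Finset.sum_congr rfl fun j _ => ?_
  rw [diagonal_mul, diagonal_mul, transpose_apply]
  ring

theorem Orth.sum_sq {W : Matrix (Fin n) (Fin n) ℝ} (hW : Orth W) :
    ∑ i, ∑ j, W i j ^ 2 = n := by
  rw [← norm_sq_sum, norm_sq_trace, hW.1]
  simp

theorem inv_spec {U : Matrix (Fin n) (Fin n) ℝ} (hU : Orth U) {l : Fin n → ℝ}
    (hl : ∀ i, 0 < l i) : (U * diagonal l * Uᵀ)⁻¹ = U * diagonal (fun i => (l i)⁻¹) * Uᵀ := by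
  apply Matrix.inv_eq_right_inv
  have : U * diagonal l * Uᵀ * (U * diagonal (fun i => (l i)⁻¹) * Uᵀ)
      = U * (diagonal l * (Uᵀ * U) * diagonal (fun i => (l i)⁻¹)) * Uᵀ := by
    simp only [Matrix.mul_assoc]
  rw [this, hU.1, Matrix.mul_one, diagonal_mul_diagonal]
  have : (fun i => l i * (l i)⁻¹) = fun _ => 1 := by
    ext i; exact mul_inv_cancel₀ (hl i).ne'
  rw [this, diagonal_one, Matrix.mul_one, hU.2]

theorem four_sinh_sq (x : ℝ) : Real.exp x + Real.exp (-x) - 2 = (2 * Real.sinh (x / 2)) ^ 2 := by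
  have h : Real.exp (x) = Real.exp (x/2) ^ 2 := by
    rw [← Real.exp_nat_mul]; congr 1; push_cast; ring
  have h2 : Real.exp (-x) = Real.exp (-(x/2)) ^ 2 := by
    rw [← Real.exp_nat_mul]; congr 1; push_cast; ring
  have h3 : Real.exp (x/2) * Real.exp (-(x/2)) = 1 := by rw [← Real.exp_add]; simp
  rw [Real.sinh_eq, h, h2]
  linear_combination 2 * h3

theorem sq_le_sinh (x : ℝ) : x ^ 2 ≤ (2 * Real.sinh (x / 2)) ^ 2 := by
  apply sq_le_sq.2
  rw [abs_mul, ← abs_sinh' (x/2)]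
  have : |x / 2| ≤ Real.sinh |x / 2| := Real.self_le_sinh_iff.2 (abs_nonneg _)
  rw [abs_div, abs_two] at *
  linarith
where abs_sinh' (x : ℝ) : Real.sinh |x| = |Real.sinh x| := (Real.abs_sinh x).symm

theorem log_sq_le {x : ℝ} (hx : 0 < x) : Real.log x ^ 2 ≤ x + x⁻¹ - 2 := by
  have := sq_le_sinh (Real.log x)
  rwa [← four_sinh_sq, Real.exp_neg, Real.exp_log hx] at this

theorem emi_step {P Q : Matrix (Fin n) (Fin n) ℝ} (hP : P.PosDef) (hQ : Q.PosDef) :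
    ‖lg Q - lg P‖ ^ 2 ≤ (Q * P⁻¹).trace + (P * Q⁻¹).trace - 2 * n := by
  obtain ⟨U, l, hU, hl, h1, -, h3⟩ := spec_pos hP
  obtain ⟨V, m, hV, hm, k1, -, k3⟩ := spec_pos hQ
  rw [lg, lg, h3, k3, mixed_norm hU hV, trace_mul_comm P, h1, k1, inv_spec hU hl, inv_spec hV hm,
    mixed_trace, mixed_trace, ← (hU.transpose.mul hV).sum_sq, Finset.mul_sum,
    ← Finset.sum_add_distrib, ← Finset.sum_sub_distrib]
  refine Finset.sum_le_sum fun i _ => ?_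
  rw [Finset.mul_sum, ← Finset.sum_add_distrib, ← Finset.sum_sub_distrib]
  refine Finset.sum_le_sum fun j _ => ?_
  have := log_sq_le (div_pos (hm j) (hl i))
  rw [Real.log_div (hm j).ne' (hl i).ne', inv_div] at this
  have h2 := mul_le_mul_of_nonneg_right this (sq_nonneg ((Uᵀ * V) i j))
  refine h2.trans_eq ?_
  simp only [div_eq_mul_inv]
  ring

theorem sinh_le_mul_cosh {x : ℝ} (hx : 0 ≤ x) : Real.sinh x ≤ x * Real.cosh x := by
  have hmono : MonotoneOn (fun x => x * Real.cosh x - Real.sinh x) (Set.Ici 0) := by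
    have hd : ∀ x, HasDerivAt (fun x => x * Real.cosh x - Real.sinh x) (x * Real.sinh x) x := by
      intro x
      have := ((hasDerivAt_id x).mul (Real.hasDerivAt_cosh x)).sub (Real.hasDerivAt_sinh x)
      refine this.congr_deriv ?_
      simp
    apply monotoneOn_of_deriv_nonneg (convex_Ici 0)
    · exact fun x _ => (hd x).continuousAt.continuousWithinAt
    · exact fun x _ => (hd x).differentiableAt.differentiableWithinAt
    · intro x hx
      rw [(hd x).deriv]
      simp only [interior_Ici, Set.mem_Ioi] at hx
      exact mul_nonneg hx.le (Real.sinh_nonneg_iff.2 hx.le)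
  have := hmono (Set.mem_Ici.2 le_rfl) (Set.mem_Ici.2 hx) hx
  simp at this
  linarith

theorem sinh_sq_le (x : ℝ) : (2 * Real.sinh (x / 2)) ^ 2 ≤ x ^ 2 * Real.cosh (x / 2) ^ 2 := by
  have h := sinh_le_mul_cosh (abs_nonneg (x / 2))
  rw [← Real.abs_sinh, Real.cosh_abs, abs_div] at h
  norm_num at h
  rw [← mul_pow]
  apply sq_le_sq.2
  rw [abs_mul, abs_mul, abs_of_pos (Real.cosh_pos _)]
  norm_num
  linarith

theorem exp_smul_add (L : Matrix (Fin n) (Fin n) ℝ) (s t : ℝ) :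
    NormedSpace.exp ((s + t) • L) = NormedSpace.exp (s • L) * NormedSpace.exp (t • L) := by
  rw [add_smul, Matrix.exp_add_of_commute]
  exact ((Commute.refl L).smul_left s).smul_right t

theorem trace_exp {L U : Matrix (Fin n) (Fin n) ℝ} (hU : Orth U) {l : Fin n → ℝ}
    (hL : L = U * diagonal l * Uᵀ) (t : ℝ) :
    (NormedSpace.exp (t • L)).trace = ∑ i, Real.exp (t * l i) := by
  have : t • L = U * diagonal (t • l) * Uᵀ := by
    rw [diagonal_smul, Matrix.mul_smul, Matrix.smul_mul, hL]
  rw [this, exp_spec hU, trace_mul_comm, ← Matrix.mul_assoc, hU.1, Matrix.one_mul]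
  simp [Matrix.trace]

theorem herm_smul {L : Matrix (Fin n) (Fin n) ℝ} (hL : L.IsHermitian) (t : ℝ) :
    (t • L).IsHermitian := by
  rw [isHermitian_iff_transpose] at *
  rw [transpose_smul, hL]

theorem emi_geo {K L : Matrix (Fin n) (Fin n) ℝ} (hK : IsUnit K) (hL : L.IsHermitian) :
    ‖lg (K * NormedSpace.exp L * Kᵀ) - lg (K * Kᵀ)‖ ≤ ‖L‖ := by
  obtain ⟨U, l, hU, h1, -, -⟩ := spec hL
  set g : ℝ → Matrix (Fin n) (Fin n) ℝ := fun t => K * NormedSpace.exp (t • L) * Kᵀ with hg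
  have hdet : IsUnit K.det := (Matrix.isUnit_iff_isUnit_det _).1 hK
  have hpd : ∀ t, (g t).PosDef := fun t => posDef_conj (posDef_exp (herm_smul hL t)) hK
  have htr : ∀ s t, (g (s + t) * (g s)⁻¹).trace = ∑ i, Real.exp (t * l i) := by
    intro s t
    have e : g (s + t) = (K * NormedSpace.exp (t • L) * K⁻¹) * g s := by
      simp only [hg]
      rw [add_comm, exp_smul_add]
      simp only [Matrix.mul_assoc]
      rw [← Matrix.mul_assoc K⁻¹, Matrix.nonsing_inv_mul _ hdet, Matrix.one_mul]
    rw [e, Matrix.mul_assoc, Matrix.mul_nonsing_inv _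
      ((Matrix.isUnit_iff_isUnit_det _).1 (hpd s).isUnit), Matrix.mul_one, trace_mul_comm,
      ← Matrix.mul_assoc, Matrix.nonsing_inv_mul _ hdet, Matrix.one_mul, trace_exp hU h1]
  have step : ∀ s t : ℝ, ‖lg (g (s + t)) - lg (g s)‖
      ≤ Real.sqrt (∑ i, (2 * Real.sinh (t * l i / 2)) ^ 2) := by
    intro s t
    apply Real.le_sqrt_of_sq_le
    refine (emi_step (hpd s) (hpd (s + t))).trans_eq ?_
    rw [htr]
    have := htr (s + t) (-t)
    rw [add_neg_cancel_right] at this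
    rw [this, ← Finset.sum_add_distrib]
    have h2 : (2 * (n : ℝ)) = ∑ i : Fin n, (2 : ℝ) := by simp [mul_comm]
    rw [h2, ← Finset.sum_sub_distrib]
    refine Finset.sum_congr rfl fun i _ => ?_
    rw [← four_sinh_sq, neg_mul]
  have chain : ∀ (t : ℝ) (k : ℕ), ‖lg (g (k * t)) - lg (g 0)‖
      ≤ k * Real.sqrt (∑ i, (2 * Real.sinh (t * l i / 2)) ^ 2) := by
    intro t k
    induction k with
    | zero => simp
    | succ k ih =>
      have := step (k * t) t
      have e : ((k + 1 : ℕ) : ℝ) * t = k * t + t := by push_cast; ring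
      rw [e]
      have h3 := norm_sub_le_norm_sub_add_norm_sub (lg (g (k * t + t))) (lg (g (k * t))) (lg (g 0))
      push_cast
      linarith
  have fin : ∀ m : ℕ, ‖lg (g 1) - lg (g 0)‖ ≤
      Real.sqrt (∑ i, l i ^ 2 * Real.cosh ((1 / ((m : ℝ) + 1)) * l i / 2) ^ 2) := by
    intro m
    have hm : (0 : ℝ) < (m : ℝ) + 1 := by positivity
    have := chain (1 / ((m : ℝ) + 1)) (m + 1)
    have e : ((m + 1 : ℕ) : ℝ) * (1 / ((m : ℝ) + 1)) = 1 := by push_cast; field_simp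
    rw [e] at this
    refine this.trans ?_
    apply Real.le_sqrt_of_sq_le
    rw [mul_pow, Real.sq_sqrt (by positivity), Finset.mul_sum]
    refine Finset.sum_le_sum fun i _ => ?_
    refine (mul_le_mul_of_nonneg_left (sinh_sq_le _) (by positivity)).trans_eq ?_
    push_cast
    field_simp
  have lim : Tendsto (fun m : ℕ => Real.sqrt (∑ i, l i ^ 2 *
      Real.cosh ((1 / ((m : ℝ) + 1)) * l i / 2) ^ 2)) atTop
      (nhds (Real.sqrt (∑ i, l i ^ 2 * Real.cosh (0 * l i / 2) ^ 2))) := by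
    have hc : Continuous (fun x : ℝ => Real.sqrt (∑ i, l i ^ 2 * Real.cosh (x * l i / 2) ^ 2)) := by
      apply Real.continuous_sqrt.comp
      refine continuous_finsetSum _ fun i _ => ?_
      have : Continuous fun x : ℝ => Real.cosh (x * l i / 2) :=
        Real.continuous_cosh.comp (by fun_prop)
      fun_prop
    exact (hc.tendsto 0).comp tendsto_one_div_add_atTop_nhds_zero_nat
  have := ge_of_tendsto lim (Eventually.of_forall fin)
  simp only [zero_mul, zero_div, Real.cosh_zero, one_pow, mul_one] at this
  rw [← norm_sq_spec hU, ← h1, Real.sqrt_sq (norm_nonneg _)] at this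
  simpa [hg] using this

theorem dR_conj {K p q : Matrix (Fin n) (Fin n) ℝ} (hK : IsUnit K) (hp : p.PosDef)
    (hq : q.PosDef) : dR (K * p * Kᵀ) (K * q * Kᵀ) = dR p q := by
  obtain ⟨h1, h2⟩ := msqrt_props hp
  set G := msqrt p with hGd
  have hG : IsUnit G.det := (Matrix.isUnit_iff_isUnit_det _).1 h1.isUnit
  have hGt : Gᵀ = G := isHermitian_iff_transpose.1 h1.isHermitian
  have hGt' : G⁻¹ᵀ = G⁻¹ := isHermitian_iff_transpose.1 h1.isHermitian.inv
  have hq' : (G⁻¹ * q * G⁻¹).PosDef := by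
    have := posDef_conj hq (K := G⁻¹) ((Matrix.isUnit_nonsing_inv_iff).2 h1.isUnit)
    rwa [hGt'] at this
  have := dR_factor (hK.mul h1.isUnit) hq'
  rw [dR_eq hp hq, ← hGd, ← this, transpose_mul, hGt]
  congr 1
  · rw [← h2]; simp only [Matrix.mul_assoc]
  · have : K * G * (G⁻¹ * q * G⁻¹) * (G * Kᵀ) = K * ((G * G⁻¹) * q * (G⁻¹ * G)) * Kᵀ := by
      simp only [Matrix.mul_assoc]
    rw [this, Matrix.mul_nonsing_inv _ hG, Matrix.nonsing_inv_mul _ hG, Matrix.one_mul,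
      Matrix.mul_one]

/-- exponential coordinates based at `p` -/
theorem coords {p q : Matrix (Fin n) (Fin n) ℝ} (hp : p.PosDef) (hq : q.PosDef) :
    q = msqrt p * NormedSpace.exp (lg ((msqrt p)⁻¹ * q * (msqrt p)⁻¹)) * msqrt p ∧
    (lg ((msqrt p)⁻¹ * q * (msqrt p)⁻¹)).IsHermitian := by
  obtain ⟨h1, h2⟩ := msqrt_props hp
  set G := msqrt p with hGd
  have hG : IsUnit G.det := (Matrix.isUnit_iff_isUnit_det _).1 h1.isUnit
  have hGt' : G⁻¹ᵀ = G⁻¹ := isHermitian_iff_transpose.1 h1.isHermitian.inv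
  have hq' : (G⁻¹ * q * G⁻¹).PosDef := by
    have := posDef_conj hq (K := G⁻¹) ((Matrix.isUnit_nonsing_inv_iff).2 h1.isUnit)
    rwa [hGt'] at this
  refine ⟨?_, lg_herm hq'⟩
  rw [exp_lg hq']
  have : G * (G⁻¹ * q * G⁻¹) * G = (G * G⁻¹) * q * (G⁻¹ * G) := by
    simp only [Matrix.mul_assoc]
  rw [this, Matrix.mul_nonsing_inv _ hG, Matrix.nonsing_inv_mul _ hG, Matrix.one_mul,
      Matrix.mul_one]

theorem emi {p q : Matrix (Fin n) (Fin n) ℝ} (hp : p.PosDef) (hq : q.PosDef) :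
    ‖lg q - lg p‖ ≤ dR p q := by
  obtain ⟨h1, h2⟩ := msqrt_props hp
  obtain ⟨k1, k2⟩ := coords hp hq
  have := emi_geo h1.isUnit k2
  rw [isHermitian_iff_transpose.1 h1.isHermitian, ← k1, h2, ← dR_eq hp hq] at this
  exact this

theorem dR_conj_exp {G A B : Matrix (Fin n) (Fin n) ℝ} (hG : G.PosDef) (hA : A.IsHermitian)
    (hB : B.IsHermitian) :
    dR (G * NormedSpace.exp A * G) (G * NormedSpace.exp B * G)
      = dR (NormedSpace.exp A) (NormedSpace.exp B) := by
  have := dR_conj hG.isUnit (posDef_exp hA) (posDef_exp hB)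
  rwa [isHermitian_iff_transpose.1 hG.isHermitian] at this

theorem emi_exp {A B : Matrix (Fin n) (Fin n) ℝ} (hA : A.IsHermitian)
    (hB : B.IsHermitian) : ‖B - A‖ ≤ dR (NormedSpace.exp A) (NormedSpace.exp B) := by
  have := emi (posDef_exp hA) (posDef_exp hB)
  rwa [lg_exp hA, lg_exp hB] at this

theorem dR_triangle {p q r : Matrix (Fin n) (Fin n) ℝ} (hp : p.PosDef) (hq : q.PosDef)
    (hr : r.PosDef) : dR p r ≤ dR p q + dR q r := by
  obtain ⟨k1, k2⟩ := coords hp hq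
  obtain ⟨l1, l2⟩ := coords hp hr
  have h := dR_conj_exp (msqrt_props hp).1 k2 l2
  rw [← k1, ← l1] at h
  have h2 := emi_exp k2 l2
  rw [← h] at h2
  rw [dR_eq hp hr, dR_eq hp hq]
  linarith [norm_sub_norm_le (lg ((msqrt p)⁻¹ * r * (msqrt p)⁻¹)) (lg ((msqrt p)⁻¹ * q * (msqrt p)⁻¹))]

theorem dR_symm {p q : Matrix (Fin n) (Fin n) ℝ} (hp : p.PosDef) (hq : q.PosDef) :
    dR p q = dR q p := by
  obtain ⟨h1, h2⟩ := msqrt_props hp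
  obtain ⟨k1, k2⟩ := coords hp hq
  rw [dR_eq hp hq]
  set L := lg ((msqrt p)⁻¹ * q * (msqrt p)⁻¹)
  set G := msqrt p
  have hGt : Gᵀ = G := isHermitian_iff_transpose.1 h1.isHermitian
  have hH := herm_smul k2 (1/2)
  set H := NormedSpace.exp ((1/2 : ℝ) • L) with hHd
  have hHpd : H.PosDef := posDef_exp hH
  have hHt : Hᵀ = H := isHermitian_iff_transpose.1 hHpd.isHermitian
  have hHH : H * H = NormedSpace.exp L := by
    rw [hHd, ← exp_smul_add]; norm_num
  have hHLH : H * NormedSpace.exp ((-1 : ℝ) • L) * H = 1 := by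
    rw [hHd, ← exp_smul_add, ← exp_smul_add]; norm_num
  have := dR_factor (h1.isUnit.mul hHpd.isUnit) (posDef_exp (herm_smul k2 (-1)))
  rw [lg_exp (herm_smul k2 (-1)), transpose_mul, hGt, hHt] at this
  have e1 : G * H * (H * G) = q := by
    rw [k1, ← hHH]; simp only [Matrix.mul_assoc]
  have e2 : G * H * NormedSpace.exp ((-1 : ℝ) • L) * (H * G) = p := by
    have : G * H * NormedSpace.exp ((-1 : ℝ) • L) * (H * G)
      = G * (H * NormedSpace.exp ((-1 : ℝ) • L) * H) * G := by simp only [Matrix.mul_assoc]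
    rw [this, hHLH, Matrix.mul_one, h2]
  rw [e1, e2] at this
  rw [this, norm_smul]
  simp

theorem lg_le {W : Matrix (Fin n) (Fin n) ℝ} (hW : W.PosDef) {η : ℝ} (hη : η < 1)
    (h : ‖W - 1‖ ≤ η) : ‖lg W‖ ≤ ‖W - 1‖ / (1 - η) := by
  obtain ⟨U, l, hU, hl, h1, -, h3⟩ := spec_pos hW
  have e : W - 1 = U * diagonal (fun i => l i - 1) * Uᵀ := by
    have : (fun i => l i - 1) = l - 1 := rfl
    have hd : diagonal (l - 1) = diagonal l - (1 : Matrix (Fin n) (Fin n) ℝ) := by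
      rw [← diagonal_one, diagonal_sub]; rfl
    rw [this, hd, Matrix.mul_sub, Matrix.sub_mul, ← h1, Matrix.mul_one, hU.2]
  have hs := norm_sq_spec hU (fun i => l i - 1)
  rw [← e] at hs
  have h1η : 0 < 1 - η := by linarith
  have hli : ∀ i, 1 - η ≤ l i := by
    intro i
    have : (l i - 1) ^ 2 ≤ ‖W - 1‖ ^ 2 := by
      rw [hs]
      exact Finset.single_le_sum (f := fun i => (l i - 1) ^ 2) (fun _ _ => sq_nonneg _)
        (Finset.mem_univ i)
    have := abs_le_of_sq_le_sq' this (norm_nonneg _)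
    linarith [this.1]
  rw [le_div_iff₀ h1η]
  have hη0 : 0 ≤ η := (norm_nonneg _).trans h
  apply le_of_sq_le_sq _ (norm_nonneg _)
  rw [mul_pow, lg, h3, norm_sq_spec hU, hs, Finset.sum_mul]
  refine Finset.sum_le_sum fun i _ => ?_
  rw [← mul_pow]
  apply sq_le_sq.2
  rw [abs_mul, abs_of_pos h1η, Function.comp_apply]
  have hli' := hli i
  rcases le_total 1 (l i) with h5 | h5
  · rw [abs_of_nonneg (Real.log_nonneg h5), abs_of_nonneg (by linarith)]
    have := Real.log_le_sub_one_of_pos (hl i)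
    have h6 := Real.log_nonneg h5
    nlinarith
  · rw [abs_of_nonpos (Real.log_nonpos (hl i).le h5), abs_of_nonpos (by linarith)]
    have := Real.log_le_sub_one_of_pos (inv_pos.2 (hl i))
    rw [Real.log_inv] at this
    have h6 := Real.log_nonpos (hl i).le h5
    calc -Real.log (l i) * (1 - η) ≤ -Real.log (l i) * l i := by
          apply mul_le_mul_of_nonneg_left hli'; linarith
      _ ≤ ((l i)⁻¹ - 1) * l i := by apply mul_le_mul_of_nonneg_right this (hl i).le
      _ = -(l i - 1) := by rw [sub_mul, inv_mul_cancel₀ (hl i).ne']; ring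
where le_of_sq_le_sq {a b : ℝ} (h : a ^ 2 ≤ b ^ 2) (hb : 0 ≤ b) : a ≤ b :=
  abs_le_of_sq_le_sq h hb |> (le_abs_self a).trans

end
end SPDAux

namespace SPDAux
section
open SPD
open scoped Matrix.Norms.Frobenius

variable {n : ℕ}

theorem hasFDerivAt_mexp (C : Matrix (Fin n) (Fin n) ℝ) :
    HasFDerivAt (NormedSpace.exp : Matrix (Fin n) (Fin n) ℝ → _)
      (fderiv ℝ (NormedSpace.exp : Matrix (Fin n) (Fin n) ℝ → Matrix (Fin n) (Fin n) ℝ) C) C :=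
  (NormedSpace.exp_analytic (𝕂 := ℝ) C).differentiableAt.hasFDerivAt

theorem hasDerivAt_exp_smul (F : Matrix (Fin n) (Fin n) ℝ) :
    HasDerivAt (fun t : ℝ => NormedSpace.exp (t • F)) F 0 := by
  have := hasDerivAt_exp_smul_const (𝕂 := ℝ) F (0 : ℝ)
  refine this.congr_deriv ?_
  rw [zero_smul, NormedSpace.exp_zero, one_mul]

theorem fderiv_comm {C E : Matrix (Fin n) (Fin n) ℝ} (h : Commute C E) :
    fderiv ℝ (NormedSpace.exp : Matrix (Fin n) (Fin n) ℝ → Matrix (Fin n) (Fin n) ℝ) C E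
      = NormedSpace.exp C * E := by
  have hd : HasDerivAt (fun t : ℝ => C + t • E) E 0 := by
    have := ((hasDerivAt_id (0 : ℝ)).smul_const E).const_add C
    exact this.congr_deriv (one_smul ℝ E)
  have hf := hasFDerivAt_mexp C
  have h0 : C = C + (0 : ℝ) • E := by simp
  rw [h0] at hf
  have h1 := hf.comp_hasDerivAt (0 : ℝ) hd
  have h2 : HasDerivAt (fun t : ℝ => NormedSpace.exp C * NormedSpace.exp (t • E))
      (NormedSpace.exp C * E) 0 := (hasDerivAt_exp_smul E).const_mul (NormedSpace.exp C)
  have h3 : (NormedSpace.exp ∘ fun t : ℝ => C + t • E)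
      = fun t : ℝ => NormedSpace.exp C * NormedSpace.exp (t • E) := by
    ext1 t
    exact Matrix.exp_add_of_commute _ _ (h.smul_right t)
  rw [h3] at h1
  have := h1.unique h2
  rwa [← h0] at this

theorem fderiv_bracket (C F : Matrix (Fin n) (Fin n) ℝ) :
    fderiv ℝ (NormedSpace.exp : Matrix (Fin n) (Fin n) ℝ → Matrix (Fin n) (Fin n) ℝ) C
      (F * C - C * F) = F * NormedSpace.exp C - NormedSpace.exp C * F := by
  have key : ∀ M : Matrix (Fin n) (Fin n) ℝ, HasDerivAt
      (fun t : ℝ => NormedSpace.exp (t • F) * M * NormedSpace.exp (t • (-F))) (F * M - M * F) 0 := by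
    intro M
    have := ((hasDerivAt_exp_smul F).mul_const M).mul (hasDerivAt_exp_smul (-F))
    refine this.congr_deriv ?_
    simp [sub_eq_add_neg]
  have hf := hasFDerivAt_mexp C
  have h0 : C = NormedSpace.exp ((0 : ℝ) • F) * C * NormedSpace.exp ((0 : ℝ) • (-F)) := by simp
  rw [h0] at hf
  have h1 := hf.comp_hasDerivAt (0 : ℝ) (key C)
  have h3 : (NormedSpace.exp ∘ fun t : ℝ =>
        NormedSpace.exp (t • F) * C * NormedSpace.exp (t • (-F)))
      = fun t : ℝ => NormedSpace.exp (t • F) * NormedSpace.exp C * NormedSpace.exp (t • (-F)) := by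
    ext1 t
    have : NormedSpace.exp (t • (-F)) = (NormedSpace.exp (t • F))⁻¹ := by
      rw [smul_neg, Matrix.exp_neg]
    simp only [Function.comp_apply]
    rw [this, Matrix.exp_conj _ _ (Matrix.isUnit_exp _)]
  rw [h3] at h1
  have := h1.unique (key (NormedSpace.exp C))
  rwa [← h0] at this

/-- `sinh x / x` -/
noncomputable def sc (x : ℝ) : ℝ := if x = 0 then 1 else Real.sinh x / x

theorem sc_mono {x y : ℝ} (h : |x| ≤ y) : sc x ≤ sc y := by
  have h1 : sc x = sc |x| := by
    rcases abs_choice x with h | h <;> rw [h]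
    simp [sc, neg_div_neg_eq]
  rw [h1]
  generalize hz : |x| = z at *
  have hz0 : 0 ≤ z := hz ▸ abs_nonneg x
  clear hz h1
  rcases hz0.eq_or_lt with h0 | h0
  · subst h0
    rcases h.eq_or_lt with h2 | h2
    · rw [h2]
    · simp only [sc, if_true, h2.ne', if_false]
      rw [le_div_iff₀ h2, one_mul]
      exact Real.self_le_sinh_iff.2 h
  · have hy : 0 < y := h0.trans_le h
    simp only [sc, h0.ne', hy.ne', if_false]
    have hmono : MonotoneOn (fun x => Real.sinh x / x) (Set.Ioi 0) := by
      have hd : ∀ x ∈ Set.Ioi (0:ℝ), HasDerivAt (fun x => Real.sinh x / x)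
          ((Real.cosh x * x - Real.sinh x * 1) / x ^ 2) x := by
        intro x hx
        exact (Real.hasDerivAt_sinh x).div (hasDerivAt_id x) (ne_of_gt hx)
      apply monotoneOn_of_deriv_nonneg (convex_Ioi 0)
      · exact fun x hx => (hd x hx).continuousAt.continuousWithinAt
      · rw [interior_Ioi]
        exact fun x hx => (hd x hx).differentiableAt.differentiableWithinAt
      · rw [interior_Ioi]
        intro x hx
        rw [(hd x hx).deriv]
        apply div_nonneg _ (sq_nonneg _)
        linarith [sinh_le_mul_cosh (le_of_lt (Set.mem_Ioi.1 hx))]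
    exact hmono h0 hy h

theorem sc_nonneg {x : ℝ} : 0 ≤ sc x := by
  have h : sc 0 ≤ sc |x| := sc_mono (by simp)
  have h1 : sc x = sc |x| := by
    rcases abs_choice x with h | h <;> rw [h]
    simp [sc, neg_div_neg_eq]
  rw [h1]
  have : sc 0 = 1 := by simp [sc]
  linarith

theorem fderiv_exp_spec {U : Matrix (Fin n) (Fin n) ℝ} (hU : Orth U) (l : Fin n → ℝ)
    (E : Matrix (Fin n) (Fin n) ℝ) :
    NormedSpace.exp ((-1/2 : ℝ) • (U * diagonal l * Uᵀ)) *
    fderiv ℝ (NormedSpace.exp : Matrix (Fin n) (Fin n) ℝ → Matrix (Fin n) (Fin n) ℝ)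
      (U * diagonal l * Uᵀ) (U * E * Uᵀ) *
    NormedSpace.exp ((-1/2 : ℝ) • (U * diagonal l * Uᵀ))
      = U * (Matrix.of fun i j => E i j * sc ((l i - l j) / 2)) * Uᵀ := by
  set C := U * diagonal l * Uᵀ with hC
  let Ec : Matrix (Fin n) (Fin n) ℝ := Matrix.of fun i j => if l i = l j then E i j else 0
  let F : Matrix (Fin n) (Fin n) ℝ :=
    Matrix.of fun i j => if l i = l j then 0 else E i j / (l j - l i)
  have hm : ∀ M N : Matrix (Fin n) (Fin n) ℝ, (U * M * Uᵀ) * (U * N * Uᵀ) = U * (M * N) * Uᵀ := by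
    intro M N
    have : (U * M * Uᵀ) * (U * N * Uᵀ) = U * (M * (Uᵀ * U) * N) * Uᵀ := by
      simp only [Matrix.mul_assoc]
    rw [this, hU.1, Matrix.mul_one]
  have hE : E = Ec + (F * diagonal l - diagonal l * F) := by
    ext i j
    rw [Matrix.add_apply, Matrix.sub_apply, mul_diagonal, diagonal_mul]
    simp only [Ec, F, Matrix.of_apply]
    split_ifs with h
    · simp
    · have : l j - l i ≠ 0 := fun h' => h (by linarith)
      field_simp
      ring
  have hcomm : Commute C (U * Ec * Uᵀ) := by
    rw [commute_iff_eq, hC, hm, hm]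
    congr 2
    ext i j
    rw [mul_diagonal, diagonal_mul]
    simp only [Ec, Matrix.of_apply]
    split_ifs with h
    · rw [h, mul_comm]
    · simp
  have hsplit : U * E * Uᵀ = U * Ec * Uᵀ + ((U * F * Uᵀ) * C - C * (U * F * Uᵀ)) := by
    rw [hC, hm, hm]
    conv_lhs => rw [hE]
    rw [Matrix.mul_add, Matrix.mul_sub, Matrix.add_mul, Matrix.sub_mul]
  rw [hsplit, map_add, fderiv_comm hcomm, fderiv_bracket]
  have hhalf : (-1/2 : ℝ) • C = U * diagonal ((-1/2 : ℝ) • l) * Uᵀ := by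
    rw [diagonal_smul, Matrix.mul_smul, Matrix.smul_mul]
  rw [hhalf, hC, exp_spec hU, exp_spec hU, hm, hm, hm, ← Matrix.sub_mul, ← Matrix.mul_sub,
    ← Matrix.add_mul, ← Matrix.mul_add, hm, hm]
  congr 2
  ext i j
  rw [mul_diagonal, diagonal_mul, Matrix.add_apply, Matrix.sub_apply, mul_diagonal, diagonal_mul,
    diagonal_mul]
  simp only [Ec, F, Matrix.of_apply, Function.comp_apply, Pi.smul_apply, smul_eq_mul]
  have e3 : Real.exp (-1/2 * l i) * Real.exp (l i) = Real.exp (l i / 2) := by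
    rw [← Real.exp_add]; congr 1; ring
  have e4 : Real.exp (l j) * Real.exp (-1/2 * l j) = Real.exp (l j / 2) := by
    rw [← Real.exp_add]; congr 1; ring
  split_ifs with h
  · have : sc ((l i - l j) / 2) = 1 := by simp [sc, h]
    have e5 : Real.exp (l i / 2) * Real.exp (-1/2 * l j) = 1 := by
      rw [← Real.exp_add, h]; simp; ring
    rw [this]
    linear_combination E i j * Real.exp (-1/2 * l j) * e3 + E i j * e5
  · have hne : l j - l i ≠ 0 := fun h' => h (by linarith)
    have hne2 : (l i - l j) / 2 ≠ 0 := fun h' => h (by linarith)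
    have hne3 : l i - l j ≠ 0 := fun h' => h (by linarith)
    have e5 : Real.exp (l i / 2) * Real.exp (-1/2 * l j) = Real.exp ((l i - l j) / 2) := by
      rw [← Real.exp_add]; congr 1; ring
    have e6 : Real.exp (-1/2 * l i) * Real.exp (l j / 2) = Real.exp (-((l i - l j) / 2)) := by
      rw [← Real.exp_add]; congr 1; ring
    rw [sc, if_neg hne2, Real.sinh_eq, ← e5, ← e6, ← e3, ← e4]
    field_simp
    ring

theorem rauch {C E Z : Matrix (Fin n) (Fin n) ℝ} (hC : C.IsHermitian) (a : ℝ)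
    (hE : E = a • C + Z) (hZ : (C * Z).trace = 0) :
    ‖NormedSpace.exp ((-1/2 : ℝ) • C) *
      fderiv ℝ (NormedSpace.exp : Matrix (Fin n) (Fin n) ℝ → Matrix (Fin n) (Fin n) ℝ) C E *
      NormedSpace.exp ((-1/2 : ℝ) • C)‖ ^ 2
    ≤ a ^ 2 * ‖C‖ ^ 2 + sc (khat * ‖C‖) ^ 2 * ‖Z‖ ^ 2 := by
  obtain ⟨U, l, hU, h1, -, -⟩ := spec hC
  set Z' := Uᵀ * Z * U with hZ'
  have hZZ : Z = U * Z' * Uᵀ := by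
    have : U * Z' * Uᵀ = (U * Uᵀ) * Z * (U * Uᵀ) := by
      simp only [hZ', Matrix.mul_assoc]
    rw [this, hU.2, Matrix.one_mul, Matrix.mul_one]
  have hE' : E = U * (a • diagonal l + Z') * Uᵀ := by
    rw [Matrix.mul_add, Matrix.add_mul, ← hZZ, Matrix.mul_smul, Matrix.smul_mul, ← h1, hE]
  have hCn : ‖C‖ ^ 2 = ∑ i, l i ^ 2 := by rw [h1, norm_sq_spec hU]
  have hZn : ‖Z‖ ^ 2 = ∑ i, ∑ j, Z' i j ^ 2 := by
    rw [hZZ, hU.transpose.norm_right, hU.norm_left, norm_sq_sum]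
  have htr : ∑ i, l i * Z' i i = 0 := by
    rw [← hZ, h1]
    have : (U * diagonal l * Uᵀ * Z).trace = (diagonal l * Z').trace := by
      rw [hZ', Matrix.mul_assoc U, Matrix.mul_assoc U, trace_mul_comm]
      simp only [Matrix.mul_assoc]
    rw [this]
    simp [Matrix.trace, diagonal_mul]
  have hmain := fderiv_exp_spec hU l (a • diagonal l + Z')
  rw [← hE', ← h1] at hmain
  rw [hmain, hU.transpose.norm_right, hU.norm_left, norm_sq_sum, hCn, hZn]
  have hS : ∀ i j, sc ((l i - l j) / 2) ≤ sc (khat * ‖C‖) := by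
    intro i j
    apply sc_mono
    have hk : 0 ≤ khat * ‖C‖ := by unfold khat; positivity
    apply abs_le_of_sq_le_sq _ hk
    have hk2 : khat ^ 2 = 1 / 2 := by
      unfold khat; rw [inv_pow, Real.sq_sqrt (by norm_num)]; norm_num
    rw [mul_pow, hk2, hCn]
    by_cases hij : i = j
    · subst hij
      have : 0 ≤ ∑ i, l i ^ 2 := by positivity
      simp; linarith
    · have : l i ^ 2 + l j ^ 2 ≤ ∑ i, l i ^ 2 := by
        rw [← Finset.sum_pair (f := fun i => l i ^ 2) hij]
        exact Finset.sum_le_sum_of_subset_of_nonneg (Finset.subset_univ _)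
          (fun _ _ _ => sq_nonneg _)
      nlinarith [sq_nonneg (l i + l j)]
  calc ∑ i, ∑ j, (Matrix.of fun i j => (a • diagonal l + Z') i j * sc ((l i - l j) / 2)) i j ^ 2
      ≤ ∑ i, ∑ j, ((if i = j then a ^ 2 * l i ^ 2 + 2 * a * (l i * Z' i i) else 0)
          + sc (khat * ‖C‖) ^ 2 * Z' i j ^ 2) := by
        refine Finset.sum_le_sum fun i _ => Finset.sum_le_sum fun j _ => ?_
        have h2 : sc ((l i - l j) / 2) ^ 2 ≤ sc (khat * ‖C‖) ^ 2 :=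
          pow_le_pow_left₀ sc_nonneg (hS i j) 2
        simp only [Matrix.of_apply, Matrix.add_apply, Matrix.smul_apply, diagonal_apply,
          smul_eq_mul]
        have h3 := mul_le_mul_of_nonneg_right h2 (sq_nonneg (Z' i j))
        split_ifs with hij
        · subst hij
          have : sc ((l i - l i) / 2) = 1 := by simp [sc]
          rw [this] at h3 ⊢
          nlinarith
        · rw [mul_zero, zero_add, zero_add, mul_pow]
          linarith
    _ = a ^ 2 * ∑ i, l i ^ 2 + sc (khat * ‖C‖) ^ 2 * ∑ i, ∑ j, Z' i j ^ 2 := by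
        simp only [Finset.sum_add_distrib, Finset.sum_ite_eq, Finset.mem_univ, if_true]
        rw [← Finset.mul_sum, ← Finset.mul_sum, htr]
        simp only [Finset.mul_sum]
        simp

end
end SPDAux

namespace SPDAux
section
open SPD

theorem ode_pos {M M1 M2 : ℝ → ℝ} (h1 : ∀ x, HasDerivAt M (M1 x) x)
    (h2 : ∀ x, HasDerivAt M1 (M2 x) x) (h0 : M 0 = 0) (h01 : M1 0 = 0)
    (h : ∀ x, M x ≤ M2 x) {b : ℝ} (hb : 0 ≤ b) : 0 ≤ M b := by
  have a1 : ∀ x, HasDerivAt (fun x => Real.exp x * (M1 x - M x))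
      (Real.exp x * (M1 x - M x) + Real.exp x * (M2 x - M1 x)) x := fun x =>
    (Real.hasDerivAt_exp x).mul ((h2 x).sub (h1 x))
  have m1 : Monotone (fun x => Real.exp x * (M1 x - M x)) := by
    apply monotone_of_deriv_nonneg (fun x => (a1 x).differentiableAt)
    intro x
    rw [(a1 x).deriv]
    nlinarith [Real.exp_pos x, h x]
  have k1 : ∀ x, 0 ≤ x → M x ≤ M1 x := by
    intro x hx
    have := m1 hx
    simp only [h0, h01, sub_self, mul_zero] at this
    have := (mul_nonneg_iff_of_pos_left (Real.exp_pos x)).1 this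
    linarith
  have a2 : ∀ x, HasDerivAt (fun x => Real.exp (-x) * M x)
      (Real.exp (-x) * (-1) * M x + Real.exp (-x) * M1 x) x := fun x =>
    ((hasDerivAt_neg x).exp).mul (h1 x)
  have m2 : MonotoneOn (fun x => Real.exp (-x) * M x) (Set.Ici 0) := by
    apply monotoneOn_of_deriv_nonneg (convex_Ici 0)
    · exact fun x _ => (a2 x).continuousAt.continuousWithinAt
    · exact fun x _ => (a2 x).differentiableAt.differentiableWithinAt
    · rw [interior_Ici]
      intro x hx
      rw [(a2 x).deriv]
      nlinarith [Real.exp_pos (-x), k1 x (le_of_lt hx)]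
  have := m2 (Set.self_mem_Ici) (Set.mem_Ici.2 hb) hb
  simp only [h0, mul_zero] at this
  exact (mul_nonneg_iff_of_pos_left (Real.exp_pos _)).1 this

theorem sinh_pos {x : ℝ} (hx : 0 < x) : 0 < Real.sinh x := Real.sinh_pos_iff.2 hx

theorem self_le_sinh_cosh {x : ℝ} (hx : 0 ≤ x) : x ≤ Real.sinh x * Real.cosh x := by
  have h1 := Real.self_le_sinh_iff.2 hx
  have h2 := Real.one_le_cosh x
  nlinarith

/-- `x coth x` -/
noncomputable def zt (x : ℝ) : ℝ := x * Real.cosh x / Real.sinh x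

theorem zt_mono {x y : ℝ} (hx : 0 < x) (h : x ≤ y) : zt x ≤ zt y := by
  have hmono : MonotoneOn (fun x => x * Real.cosh x / Real.sinh x) (Set.Ioi 0) := by
    have hd : ∀ x ∈ Set.Ioi (0:ℝ), HasDerivAt (fun x => x * Real.cosh x / Real.sinh x)
        (((1 * Real.cosh x + x * Real.sinh x) * Real.sinh x - x * Real.cosh x * Real.cosh x)
          / Real.sinh x ^ 2) x := by
      intro x hx
      exact ((hasDerivAt_id x).mul (Real.hasDerivAt_cosh x)).div (Real.hasDerivAt_sinh x)
        (sinh_pos hx).ne'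
    apply monotoneOn_of_deriv_nonneg (convex_Ioi 0)
    · exact fun x hx => (hd x hx).continuousAt.continuousWithinAt
    · rw [interior_Ioi]
      exact fun x hx => (hd x hx).differentiableAt.differentiableWithinAt
    · rw [interior_Ioi]
      intro x hx
      rw [(hd x hx).deriv]
      apply div_nonneg _ (sq_nonneg _)
      have := self_le_sinh_cosh (le_of_lt (Set.mem_Ioi.1 hx))
      have h3 := Real.cosh_sq x
      have : (1 * Real.cosh x + x * Real.sinh x) * Real.sinh x - x * Real.cosh x * Real.cosh x
          = Real.sinh x * Real.cosh x - x := by linear_combination (-x) * h3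
      linarith
  exact hmono hx (hx.trans_le h) h

theorem one_lt_zt {x : ℝ} (hx : 0 < x) : 1 < zt x := by
  have h0 : 0 < x / 2 := by linarith
  unfold zt
  rw [lt_div_iff₀ (sinh_pos hx), one_mul]
  have e1 : Real.sinh x = 2 * Real.sinh (x/2) * Real.cosh (x/2) := by
    rw [← Real.sinh_two_mul]; ring_nf
  have e2 : Real.cosh x = Real.cosh (x/2) ^ 2 + Real.sinh (x/2) ^ 2 := by
    rw [← Real.cosh_two_mul]; ring_nf
  have h1 := sinh_le_mul_cosh h0.le
  have h2 := sinh_pos h0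
  have h3 := Real.one_le_cosh (x/2)
  rw [e1, e2]
  nlinarith [mul_le_mul_of_nonneg_right h1 (by linarith : 0 ≤ Real.cosh (x/2)),
    mul_pos hx (pow_pos h2 2)]

theorem tanh_cubic {c q : ℝ} (hc : 0 < c) (h : c ≤ q) :
    (q - Real.sinh q / Real.cosh q) / q ^ 3 ≤ (c - Real.sinh c / Real.cosh c) / c ^ 3 := by
  have hT : ∀ x, HasDerivAt (fun x => Real.sinh x / Real.cosh x)
      (1 - (Real.sinh x / Real.cosh x) ^ 2) x := by
    intro x
    have := (Real.hasDerivAt_sinh x).div (Real.hasDerivAt_cosh x) (Real.cosh_pos x).ne'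
    refine this.congr_deriv ?_
    have := (Real.cosh_pos x).ne'
    field_simp
  set T : ℝ → ℝ := fun x => Real.sinh x / Real.cosh x with hTdef
  have hT1 : ∀ x, 0 ≤ x → 0 ≤ T x := fun x hx =>
    div_nonneg (Real.sinh_nonneg_iff.2 hx) (Real.cosh_pos x).le
  have hT2 : ∀ x, 0 ≤ x → x * (1 - T x ^ 2) ≤ T x := by
    intro x hx
    have h1 := Real.cosh_pos x
    have h2 : 1 - T x ^ 2 = 1 / Real.cosh x ^ 2 := by
      simp only [hTdef]
      have := Real.cosh_sq x
      field_simp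
      linarith
    rw [h2]
    simp only [hTdef]
    rw [mul_one_div, div_le_div_iff₀ (by positivity) h1]
    nlinarith [self_le_sinh_cosh hx]
  have hm : ∀ x, HasDerivAt (fun x => 3 * x - 3 * T x - x * T x ^ 2)
      (3 * 1 - 3 * (1 - T x ^ 2) - (1 * T x ^ 2 + x * (2 * T x * (1 - T x ^ 2)))) x := by
    intro x
    have := (((hasDerivAt_id x).const_mul 3).sub ((hT x).const_mul 3)).sub
      ((hasDerivAt_id x).mul ((hT x).pow 2))
    refine this.congr_deriv ?_
    simp [hTdef]
  have hm0 : ∀ x, 0 ≤ x → 0 ≤ 3 * x - 3 * T x - x * T x ^ 2 := by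
    intro x hx
    have hmo : MonotoneOn (fun x => 3 * x - 3 * T x - x * T x ^ 2) (Set.Ici 0) := by
      apply monotoneOn_of_deriv_nonneg (convex_Ici 0)
      · exact fun x _ => (hm x).continuousAt.continuousWithinAt
      · exact fun x _ => (hm x).differentiableAt.differentiableWithinAt
      · rw [interior_Ici]
        intro x hx
        have hx' : 0 ≤ x := le_of_lt hx
        rw [(hm x).deriv]
        nlinarith [mul_nonneg (hT1 x hx') (sub_nonneg.2 (hT2 x hx'))]
    have := hmo Set.self_mem_Ici (Set.mem_Ici.2 hx) hx
    simpa [hTdef] using this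
  have hanti : AntitoneOn (fun x => (x - T x) / x ^ 3) (Set.Ioi 0) := by
    have hd : ∀ x ∈ Set.Ioi (0:ℝ), HasDerivAt (fun x => (x - T x) / x ^ 3)
        (((1 - (1 - T x ^ 2)) * x ^ 3 - (x - T x) * (3 * x ^ 2)) / (x ^ 3) ^ 2) x := by
      intro x hx
      have := ((hasDerivAt_id x).sub (hT x)).div (hasDerivAt_pow 3 x) (pow_ne_zero 3 (ne_of_gt hx))
      refine this.congr_deriv ?_
      simp [hTdef]
    apply antitoneOn_of_deriv_nonpos (convex_Ioi 0)
    · exact fun x hx => (hd x hx).continuousAt.continuousWithinAt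
    · rw [interior_Ioi]
      exact fun x hx => (hd x hx).differentiableAt.differentiableWithinAt
    · rw [interior_Ioi]
      intro x hx
      rw [(hd x hx).deriv]
      apply div_nonpos_of_nonpos_of_nonneg _ (sq_nonneg _)
      nlinarith [mul_nonneg (sq_nonneg x) (hm0 x (le_of_lt hx))]
  exact hanti hc (hc.trans_le h) h

theorem scalar_ineq {q c r : ℝ} (hq : 0 < q) (hc : 0 < c) (hr : 0 ≤ r)
    (h : zt c * (q ^ 2 - c ^ 2) ≤ r * q ^ 2) :
    Real.cosh q ≤ Real.cosh q * r + Real.sinh q * ((zt c - r) / q) := by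
  have hs := sinh_pos hq
  have hch := Real.cosh_pos q
  have hA : 0 ≤ q * Real.cosh q - Real.sinh q := by linarith [sinh_le_mul_cosh hq.le]
  suffices hh : q * Real.cosh q ≤ r * (q * Real.cosh q - Real.sinh q) + zt c * Real.sinh q by
    have e : Real.cosh q * r + Real.sinh q * ((zt c - r) / q)
        = (r * (q * Real.cosh q - Real.sinh q) + zt c * Real.sinh q) / q := by
      field_simp; ring
    rw [e, le_div_iff₀ hq]; linarith
  rcases le_total q c with hqc | hqc
  · have h1 := zt_mono hq hqc
    have h2 : q * Real.cosh q = zt q * Real.sinh q := by unfold zt; field_simp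
    nlinarith [mul_nonneg hr hA]
  · have h1 := tanh_cubic hc hqc
    have hsc := sinh_pos hc
    have hcc := Real.cosh_pos c
    have hz : 0 < zt c := by linarith [one_lt_zt hc]
    have h2 : (c - Real.sinh c / Real.cosh c) / c ^ 3 = (zt c - 1) / (zt c * c ^ 2) := by
      unfold zt; field_simp
    have h3 : (q - Real.sinh q / Real.cosh q) / q ^ 3
      = (q * Real.cosh q - Real.sinh q) / (q ^ 3 * Real.cosh q) := by field_simp
    rw [h2, h3, div_le_div_iff₀ (by positivity) (by positivity)] at h1
    have h4 := mul_le_mul_of_nonneg_right h hA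
    have hq2 : 0 < q ^ 2 := by positivity
    by_contra! hcon
    nlinarith [mul_lt_mul_of_pos_right hcon hq2]

theorem scalar_main {b c u : ℝ} (hb : 0 ≤ b) (hc : 0 < c) (hu : u ^ 2 ≤ 1) :
    0 < c ^ 2 + zt c * b ^ 2 - 2 * b * c * u ∧
    Real.cosh b * Real.cosh c - Real.sinh b * Real.sinh c * u
      ≤ Real.cosh (Real.sqrt (c ^ 2 + zt c * b ^ 2 - 2 * b * c * u)) := by
  have hz := one_lt_zt hc
  set ζ := zt c with hζ
  let y : ℝ → ℝ := fun b => c ^ 2 + ζ * b ^ 2 - 2 * b * c * u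
  have hid : ∀ b, ζ * y b = (ζ * b - c * u) ^ 2 + c ^ 2 * (ζ - u ^ 2) := by
    intro b; simp only [y]; ring
  have hy : ∀ b, 0 < y b := by
    intro b
    have h1 : 0 < ζ * y b := by
      rw [hid]
      have : 0 < c ^ 2 * (ζ - u ^ 2) := mul_pos (by positivity) (by linarith)
      positivity
    exact (mul_pos_iff_of_pos_left (by linarith)).1 h1
  refine ⟨hy b, ?_⟩
  let q : ℝ → ℝ := fun b => Real.sqrt (y b)
  have hqp : ∀ b, 0 < q b := fun b => Real.sqrt_pos.2 (hy b)
  have hq2 : ∀ b, q b ^ 2 = y b := fun b => Real.sq_sqrt (hy b).le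
  have hyd : ∀ b, HasDerivAt y (2 * (ζ * b - c * u)) b := by
    intro b
    have := (((hasDerivAt_pow 2 b).const_mul ζ).const_add (c ^ 2)).sub
      ((((hasDerivAt_id b).const_mul 2).mul_const c).mul_const u)
    refine this.congr_deriv ?_
    simp; ring
  let q1 : ℝ → ℝ := fun b => (ζ * b - c * u) / q b
  have hqd : ∀ b, HasDerivAt q (q1 b) b := by
    intro b
    refine ((hyd b).sqrt (hy b).ne').congr_deriv ?_
    simp only [q1, q]
    rw [mul_div_mul_left _ _ two_ne_zero]
  have hq1d : ∀ b, HasDerivAt q1 ((ζ - q1 b ^ 2) / q b) b := by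
    intro b
    have := (((hasDerivAt_id b).const_mul ζ).sub_const (c * u)).div (hqd b) (hqp b).ne'
    refine this.congr_deriv ?_
    have := (hqp b).ne'
    simp only [q1, id]
    field_simp
  let M : ℝ → ℝ := fun b => Real.cosh (q b) -
    (Real.cosh b * Real.cosh c - Real.sinh b * Real.sinh c * u)
  let M1 : ℝ → ℝ := fun b => Real.sinh (q b) * q1 b -
    (Real.sinh b * Real.cosh c - Real.cosh b * Real.sinh c * u)
  let M2 : ℝ → ℝ := fun b => (Real.cosh (q b) * q1 b * q1 b + Real.sinh (q b) *
    ((ζ - q1 b ^ 2) / q b)) - (Real.cosh b * Real.cosh c - Real.sinh b * Real.sinh c * u)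
  have hM : ∀ x, HasDerivAt M (M1 x) x := fun x =>
    ((hqd x).cosh).sub (((Real.hasDerivAt_cosh x).mul_const _).sub
      (((Real.hasDerivAt_sinh x).mul_const _).mul_const u))
  have hM1 : ∀ x, HasDerivAt M1 (M2 x) x := fun x =>
    (((hqd x).sinh).mul (hq1d x)).sub (((Real.hasDerivAt_sinh x).mul_const _).sub
      (((Real.hasDerivAt_cosh x).mul_const _).mul_const u))
  have q0 : q 0 = c := by
    simp only [q, y]
    simp [Real.sqrt_sq hc.le]
  have := ode_pos hM hM1 (by simp [M, q0]) (by simp [M1, q1, q0]; field_simp; ring) (by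
    intro x
    have h1 := scalar_ineq (hqp x) hc (sq_nonneg (q1 x)) (by
      rw [hq2]
      have : q1 x ^ 2 * y x = (ζ * x - c * u) ^ 2 := by
        rw [← hq2]
        have := (hqp x).ne'
        simp only [q1]; field_simp
      rw [this]
      nlinarith [hid x, mul_nonneg (sq_nonneg c) (sq_nonneg u)])
    simp only [M, M2]
    rw [← hζ] at h1
    linarith) hb
  simp only [M] at this
  linarith

end
end SPDAux

namespace SPDAux
section
open SPD
open scoped Matrix.Norms.Frobenius
open scoped Topology

variable {n : ℕ}

theorem dR_nonneg (p q : Matrix (Fin n) (Fin n) ℝ) : 0 ≤ dR p q := Real.sqrt_nonneg _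

theorem dR_self {p : Matrix (Fin n) (Fin n) ℝ} (hp : p.PosDef) : dR p p = 0 := by
  have h := msqrt_props hp
  have hu := h.1.isUnit
  have e : (msqrt p)⁻¹ * p * (msqrt p)⁻¹ = NormedSpace.exp (0 : Matrix (Fin n) (Fin n) ℝ) := by
    rw [NormedSpace.exp_zero]
    have hd : IsUnit (msqrt p).det := (Matrix.isUnit_iff_isUnit_det _).1 hu
    have hG : ∀ G : Matrix (Fin n) (Fin n) ℝ, IsUnit G.det → G⁻¹ * (G * G) * G⁻¹ = 1 := by
      intro G hG
      rw [← Matrix.mul_assoc, Matrix.nonsing_inv_mul _ hG, Matrix.one_mul,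
        Matrix.mul_nonsing_inv _ hG]
    have := hG _ hd
    rwa [h.2] at this
  rw [dR_eq hp hp, e, lg_exp (by simp [Matrix.IsHermitian]), norm_zero]

theorem local_len {C : ℝ → Matrix (Fin n) (Fin n) ℝ} {C' : Matrix (Fin n) (Fin n) ℝ}
    (hC : ∀ s, (C s).IsHermitian) {s v r : ℝ} (hd : HasDerivAt C C' s)
    (hv : ‖NormedSpace.exp ((-1/2 : ℝ) • C s) *
      fderiv ℝ (NormedSpace.exp : Matrix (Fin n) (Fin n) ℝ → Matrix (Fin n) (Fin n) ℝ) (C s) C' *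
      NormedSpace.exp ((-1/2 : ℝ) • C s)‖ ≤ v) (hr : v < r) :
    ∀ᶠ z in 𝓝 s, dR (NormedSpace.exp (C s)) (NormedSpace.exp (C z)) ≤ r * |z - s| := by
  set P := NormedSpace.exp ((-1/2 : ℝ) • C s) with hP
  set K := NormedSpace.exp ((1/2 : ℝ) • C s) with hK
  have hv0 : 0 ≤ v := (norm_nonneg _).trans hv
  have hr0 : 0 < r := hv0.trans_lt hr
  have hKt : Kᵀ = K := isHermitian_iff_transpose.1 (posDef_exp (herm_smul (hC s) _)).1
  have hPt : Pᵀ = P := isHermitian_iff_transpose.1 (posDef_exp (herm_smul (hC s) _)).1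
  have hKu : IsUnit K := (posDef_exp (herm_smul (hC s) _)).isUnit
  have hPu : IsUnit P := (posDef_exp (herm_smul (hC s) _)).isUnit
  have hKP : K * P = 1 := by
    rw [hK, hP, ← exp_smul_add]; norm_num
  have hPK : P * K = 1 := by
    rw [hK, hP, ← exp_smul_add]; norm_num
  have hKK : K * K = NormedSpace.exp (C s) := by
    rw [hK, ← exp_smul_add]; norm_num
  let W : ℝ → Matrix (Fin n) (Fin n) ℝ := fun z => P * NormedSpace.exp (C z) * P
  have hWd : HasDerivAt W (P * fderiv ℝ
      (NormedSpace.exp : Matrix (Fin n) (Fin n) ℝ → Matrix (Fin n) (Fin n) ℝ) (C s) C' * P) s :=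
    (((hasFDerivAt_mexp (C s)).comp_hasDerivAt s hd).const_mul P).mul_const P
  have hWs : W s = 1 := by
    simp only [W]
    rw [← hKK, ← Matrix.mul_assoc, hPK, Matrix.one_mul, hKP]
  have hWp : ∀ z, (W z).PosDef := by
    intro z
    have := posDef_conj (posDef_exp (hC z)) hPu
    rwa [hPt] at this
  have hdist : ∀ z, dR (NormedSpace.exp (C s)) (NormedSpace.exp (C z)) = ‖lg (W z)‖ := by
    intro z
    rw [← dR_factor hKu (hWp z), hKt, hKK]
    congr 1
    simp only [W]
    have : K * (P * NormedSpace.exp (C z) * P) * K = (K * P) * NormedSpace.exp (C z) * (P * K) := by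
      simp only [Matrix.mul_assoc]
    rw [this, hKP, hPK, Matrix.one_mul, Matrix.mul_one]
  have hη : 0 < (r - v) / (2 * r) := by
    apply div_pos <;> linarith
  have hη1 : (r - v) / (2 * r) < 1 := by
    rw [div_lt_one (by linarith)]; linarith
  have hc0 : 0 < (r - v) / 2 := by linarith
  have h1 := (hasDerivAt_iff_isLittleO.1 hWd).def hc0
  have h2 : ∀ᶠ z in 𝓝 s, ‖W z - 1‖ < (r - v) / (2 * r) := by
    have : Tendsto (fun z => ‖W z - 1‖) (𝓝 s) (𝓝 ‖W s - 1‖) :=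
      ((hWd.continuousAt.sub continuousAt_const).norm)
    rw [hWs, sub_self, norm_zero] at this
    exact this.eventually_lt_const hη
  filter_upwards [h1, h2] with z hz1 hz2
  rw [hdist]
  refine (lg_le (hWp z) hη1 hz2.le).trans ?_
  rw [div_le_iff₀ (by linarith)]
  rw [hWs, Real.norm_eq_abs] at hz1
  set V := P * fderiv ℝ
      (NormedSpace.exp : Matrix (Fin n) (Fin n) ℝ → Matrix (Fin n) (Fin n) ℝ) (C s) C' * P
  have h3 : ‖W z - 1‖ ≤ ‖W z - 1 - (z - s) • V‖ + ‖(z - s) • V‖ := by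
    have := norm_add_le (W z - 1 - (z - s) • V) ((z - s) • V)
    simpa using this
  rw [norm_smul, Real.norm_eq_abs] at h3
  have h4 := mul_le_mul_of_nonneg_left hv (abs_nonneg (z - s))
  have h5 : r * |z - s| * (1 - (r - v) / (2 * r)) = |z - s| * (r - (r - v) / 2) := by
    field_simp
  rw [h5]
  nlinarith

theorem path_len {C C' : ℝ → Matrix (Fin n) (Fin n) ℝ} {L v : ℝ} (hL : 0 ≤ L)
    (hC : ∀ s, (C s).IsHermitian) (hd : ∀ s ∈ Set.Icc 0 L, HasDerivAt C (C' s) s)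
    (hv : ∀ s ∈ Set.Icc 0 L, ‖NormedSpace.exp ((-1/2 : ℝ) • C s) *
      fderiv ℝ (NormedSpace.exp : Matrix (Fin n) (Fin n) ℝ → Matrix (Fin n) (Fin n) ℝ) (C s) (C' s) *
      NormedSpace.exp ((-1/2 : ℝ) • C s)‖ ≤ v) :
    dR (NormedSpace.exp (C 0)) (NormedSpace.exp (C L)) ≤ v * L := by
  have hp : ∀ s, (NormedSpace.exp (C s)).PosDef := fun s => posDef_exp (hC s)
  let φ : ℝ → ℝ := fun s => dR (NormedSpace.exp (C 0)) (NormedSpace.exp (C s))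
  have hφ : ∀ s z, |φ z - φ s| ≤ dR (NormedSpace.exp (C s)) (NormedSpace.exp (C z)) := by
    intro s z
    rw [abs_le]
    have h1 := dR_triangle (hp 0) (hp s) (hp z)
    have h2 := dR_triangle (hp 0) (hp z) (hp s)
    rw [dR_symm (hp z) (hp s)] at h2
    simp only [φ]
    constructor <;> linarith
  have hcont : ContinuousOn φ (Set.Icc 0 L) := by
    intro s hs
    apply ContinuousAt.continuousWithinAt
    have h1 := local_len hC (hd s hs) (hv s hs) (lt_add_one v)
    rw [ContinuousAt, tendsto_iff_norm_sub_tendsto_zero]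
    refine squeeze_zero' (Eventually.of_forall fun _ => norm_nonneg _)
      (h1.mono fun z hz => (hφ s z).trans hz) ?_
    have : Continuous fun z : ℝ => (v + 1) * |z - s| := by fun_prop
    have := this.tendsto s
    simpa using this
  have := image_le_of_liminf_slope_right_le_deriv_boundary hcont (B := fun s => v * s)
    (B' := fun _ => v) (by simp [φ, dR_self (hp 0)]) (by fun_prop)
    (by
      intro x _
      have := ((hasDerivAt_id x).const_mul v).hasDerivWithinAt (s := Set.Ici x)
      simpa using this)
    (by
      intro x hx r hr
      have hx' : x ∈ Set.Icc 0 L := ⟨hx.1, hx.2.le⟩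
      have h1 := local_len hC (hd x hx') (hv x hx') (show v < (v + r) / 2 by linarith)
      apply Eventually.frequently
      filter_upwards [nhdsWithin_le_nhds h1, self_mem_nhdsWithin] with z hz hzx
      have hzx' : 0 < z - x := sub_pos.2 hzx
      rw [slope_def_field, div_lt_iff₀ hzx']
      have h2 := (le_abs_self _).trans ((hφ x z).trans hz)
      rw [abs_of_pos hzx'] at h2
      nlinarith)
  exact this ⟨hL, le_rfl⟩

end
end SPDAux

namespace SPDAux
section
open SPD
open scoped Matrix.Norms.Frobenius
open scoped Topology

variable {n : ℕ}

theorem norm_sq_herm {A : Matrix (Fin n) (Fin n) ℝ} (hA : A.IsHermitian) :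
    ‖A‖ ^ 2 = (A * A).trace := by
  rw [norm_sq_trace, isHermitian_iff_transpose.1 hA]

theorem trace_comb (A B : Matrix (Fin n) (Fin n) ℝ) (a b c d : ℝ) :
    ((a • A + b • B) * (c • A + d • B)).trace
      = a * c * (A * A).trace + (a * d + b * c) * (A * B).trace + b * d * (B * B).trace := by
  have h := trace_mul_comm B A
  simp only [Matrix.add_mul, Matrix.mul_add, Matrix.smul_mul, Matrix.mul_smul, trace_add,
    trace_smul, smul_eq_mul, h]
  ring

theorem herm_comb {A B : Matrix (Fin n) (Fin n) ℝ} (hA : A.IsHermitian) (hB : B.IsHermitian)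
    (a b : ℝ) : (a • A + b • B).IsHermitian := (herm_smul hA a).add (herm_smul hB b)

theorem khat_pos : 0 < khat := by unfold khat; positivity

theorem cone_speed {y yd : Matrix (Fin n) (Fin n) ℝ} {x xd : ℝ} (hy : y.IsHermitian)
    (hyd : yd.IsHermitian) (hx : 1 < x) (h1 : (y * y).trace = x ^ 2 - 1)
    (h2 : (yd * yd).trace = xd ^ 2 + 1) (h3 : (y * yd).trace = x * xd) {w R : ℝ}
    (hw : 0 < w) (hR : 0 < R) (hR2 : R ^ 2 = x ^ 2 - 1) (hwR : Real.sinh w = R)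
    {C : Matrix (Fin n) (Fin n) ℝ} (hC : C = (w / (khat * R)) • y) :
    ‖NormedSpace.exp ((-1/2 : ℝ) • C) *
      fderiv ℝ (NormedSpace.exp : Matrix (Fin n) (Fin n) ℝ → Matrix (Fin n) (Fin n) ℝ) C
        ((khat⁻¹ * (xd / R ^ 2 - w * x * xd / R ^ 3)) • y + (w / (khat * R)) • yd) *
      NormedSpace.exp ((-1/2 : ℝ) • C)‖ ≤ khat⁻¹ := by
  have hk := khat_pos
  set κ := khat with hκ
  have hCh : C.IsHermitian := hC ▸ herm_smul hy _
  set g := w / (κ * R) with hg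
  have hg0 : 0 < g := by positivity
  set Z : Matrix (Fin n) (Fin n) ℝ := (-(g * (x * xd / R ^ 2))) • y + g • yd with hZ
  have hE : (κ⁻¹ * (xd / R ^ 2 - w * x * xd / R ^ 3)) • y + g • yd
      = (xd / (R * w)) • C + Z := by
    rw [hC, hZ, smul_smul, ← add_assoc, ← add_smul]
    congr 2
    rw [hg]
    field_simp
    ring
  have hCZ : (C * Z).trace = 0 := by
    have : C = g • y + (0 : ℝ) • yd := by rw [hC]; simp
    rw [this, hZ, trace_comb, h1, h3, ← hR2]
    field_simp
    ring
  have hCn : ‖C‖ = w / κ := by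
    rw [← sq_eq_sq₀ (norm_nonneg _) (by positivity), norm_sq_herm hCh]
    have : C = g • y + (0 : ℝ) • yd := by rw [hC]; simp
    rw [this, trace_comb, h1, ← hR2, hg]
    field_simp
    ring
  have hZn : ‖Z‖ ^ 2 = g ^ 2 * (xd ^ 2 + 1 - x ^ 2 * xd ^ 2 / R ^ 2) := by
    rw [norm_sq_herm (herm_comb hy hyd _ _), trace_comb, h1, h2, h3, ← hR2]
    field_simp
    ring
  have hsc : sc (κ * ‖C‖) = R / w := by
    have : κ * ‖C‖ = w := by rw [hCn]; field_simp
    rw [this, sc, if_neg hw.ne', hwR]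
  have := rauch hCh _ hE hCZ
  rw [← hκ, hsc, hZn, hCn] at this
  refine abs_le_of_sq_le_sq' ?_ (by positivity) |>.2
  refine this.trans (le_of_eq ?_)
  have hx2 : x ^ 2 = R ^ 2 + 1 := by linarith
  rw [hx2, hg]
  field_simp
  ring

theorem hyp_dist {U V : Matrix (Fin n) (Fin n) ℝ} (hU : U.IsHermitian) (hV : V.IsHermitian)
    (hU1 : (U * U).trace = 1) (hV1 : (V * V).trace = 1) {u : ℝ} (hu : (U * V).trace = u)
    (hu1 : u ^ 2 < 1) {b c a : ℝ} (hb : 0 < b) (hc : 0 < c) (ha : 0 < a)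
    (hcos : Real.cosh a = Real.cosh b * Real.cosh c - Real.sinh b * Real.sinh c * u) :
    dR (NormedSpace.exp ((b / khat) • U)) (NormedSpace.exp ((c / khat) • V)) ≤ khat⁻¹ * a := by
  have hk := khat_pos
  have hsa := sinh_pos ha
  have hsb := sinh_pos hb
  have hsc := sinh_pos hc
  let p : ℝ → ℝ := fun s => Real.sinh (a - s) / Real.sinh a
  let q : ℝ → ℝ := fun s => Real.sinh s / Real.sinh a
  let pd : ℝ → ℝ := fun s => -(Real.cosh (a - s) / Real.sinh a)
  let qd : ℝ → ℝ := fun s => Real.cosh s / Real.sinh a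
  have hp : ∀ s, HasDerivAt p (pd s) s := by
    intro s
    have := (((hasDerivAt_id s).const_sub a).sinh).div_const (Real.sinh a)
    refine this.congr_deriv ?_
    simp [pd]; ring
  have hq : ∀ s, HasDerivAt q (qd s) s := fun s => (Real.hasDerivAt_sinh s).div_const _
  have i1 : ∀ s, p s ^ 2 + q s ^ 2 + 2 * (p s * q s) * Real.cosh a = 1 := by
    intro s
    simp only [p, q, Real.sinh_sub]
    have e1 := Real.cosh_sq a
    have e2 := Real.cosh_sq s
    field_simp
    linear_combination (-Real.sinh s ^ 2) * e1 + Real.sinh a ^ 2 * e2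
  have i2 : ∀ s, pd s ^ 2 + qd s ^ 2 + 2 * (pd s * qd s) * Real.cosh a = -1 := by
    intro s
    simp only [pd, qd, Real.cosh_sub]
    have e1 := Real.cosh_sq a
    have e2 := Real.cosh_sq s
    field_simp
    linear_combination (-Real.cosh s ^ 2) * e1 - Real.sinh a ^ 2 * e2
  have i3 : ∀ s, p s * pd s + q s * qd s + (p s * qd s + q s * pd s) * Real.cosh a = 0 := by
    intro s
    simp only [p, q, pd, qd, Real.cosh_sub, Real.sinh_sub]
    have e1 := Real.cosh_sq a
    field_simp
    linear_combination (-Real.sinh s * Real.cosh s) * e1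
  let y : ℝ → Matrix (Fin n) (Fin n) ℝ := fun s =>
    (p s * Real.sinh b) • U + (q s * Real.sinh c) • V
  let yd : ℝ → Matrix (Fin n) (Fin n) ℝ := fun s =>
    (pd s * Real.sinh b) • U + (qd s * Real.sinh c) • V
  let x : ℝ → ℝ := fun s => p s * Real.cosh b + q s * Real.cosh c
  let xd : ℝ → ℝ := fun s => pd s * Real.cosh b + qd s * Real.cosh c
  have hyd : ∀ s, HasDerivAt y (yd s) s := fun s =>
    (((hp s).mul_const _).smul_const U).add (((hq s).mul_const _).smul_const V)
  have hxd : ∀ s, HasDerivAt x (xd s) s := fun s =>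
    ((hp s).mul_const _).add ((hq s).mul_const _)
  have eb := Real.cosh_sq b
  have ec := Real.cosh_sq c
  have t1 : ∀ s, (y s * y s).trace = x s ^ 2 - 1 := by
    intro s
    simp only [y, x]
    rw [trace_comb, hU1, hV1, hu]
    linear_combination (-1) * i1 s + 2 * p s * q s * hcos - p s ^ 2 * eb - q s ^ 2 * ec
  have t2 : ∀ s, (yd s * yd s).trace = xd s ^ 2 + 1 := by
    intro s
    simp only [yd, xd]
    rw [trace_comb, hU1, hV1, hu]
    linear_combination (-1) * i2 s + 2 * pd s * qd s * hcos - pd s ^ 2 * eb - qd s ^ 2 * ec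
  have t3 : ∀ s, (y s * yd s).trace = x s * xd s := by
    intro s
    simp only [y, yd, x, xd]
    rw [trace_comb, hU1, hV1, hu]
    linear_combination (-1) * i3 s + (p s * qd s + q s * pd s) * hcos - p s * pd s * eb
      - q s * qd s * ec
  have hx1 : ∀ s ∈ Set.Icc 0 a, 1 < x s := by
    intro s hs
    have hp0 : 0 ≤ p s := div_nonneg (Real.sinh_nonneg_iff.2 (by linarith [hs.2])) hsa.le
    have hq0 : 0 ≤ q s := div_nonneg (Real.sinh_nonneg_iff.2 hs.1) hsa.le
    have hx0 : 0 ≤ x s := add_nonneg (mul_nonneg hp0 (Real.cosh_pos b).le)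
      (mul_nonneg hq0 (Real.cosh_pos c).le)
    have hpos : 0 < (y s * y s).trace := by
      simp only [y]
      rw [trace_comb, hU1, hV1, hu]
      have e : p s * sinh b * (p s * sinh b) * 1 +
          (p s * sinh b * (q s * sinh c) + q s * sinh c * (p s * sinh b)) * u +
          q s * sinh c * (q s * sinh c) * 1
          = (p s * sinh b + u * (q s * sinh c)) ^ 2 + (1 - u ^ 2) * (q s * sinh c) ^ 2 := by ring
      rw [e]
      have hu2 : 0 < 1 - u ^ 2 := by linarith
      rcases hq0.eq_or_lt with h | h
      · have := i1 s
        rw [← h] at this ⊢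
        have hp1 : p s ≠ 0 := by
          intro h; rw [h] at this; norm_num at this
        have : 0 < (p s * sinh b) ^ 2 := by positivity
        simpa using this
      · positivity
    rw [t1] at hpos
    nlinarith
  have hyh : ∀ s, (y s).IsHermitian := fun s => herm_comb hU hV _ _
  let w : ℝ → ℝ := fun s => Real.arcosh (x s)
  let R : ℝ → ℝ := fun s => Real.sqrt (x s ^ 2 - 1)
  let C : ℝ → Matrix (Fin n) (Fin n) ℝ := fun s => (w s / (khat * R s)) • y s
  have hR2 : ∀ s ∈ Set.Icc 0 a, 0 < x s ^ 2 - 1 := fun s hs => by nlinarith [hx1 s hs]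
  have hRp : ∀ s ∈ Set.Icc 0 a, 0 < R s := fun s hs => Real.sqrt_pos.2 (hR2 s hs)
  have hRs : ∀ s ∈ Set.Icc 0 a, R s ^ 2 = x s ^ 2 - 1 := fun s hs => Real.sq_sqrt (hR2 s hs).le
  have main := path_len (C := C) (C' := fun s =>
      (khat⁻¹ * (xd s / R s ^ 2 - w s * x s * xd s / R s ^ 3)) • y s
        + (w s / (khat * R s)) • yd s) (L := a) (v := khat⁻¹) ha.le
    (fun s => herm_smul (hyh s) _) (by
      intro s hs
      have hRp' := hRp s hs
      have hwd : HasDerivAt w ((R s)⁻¹ * xd s) s :=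
        (Real.hasDerivAt_arcosh (hx1 s hs)).comp s (hxd s)
      have hRd : HasDerivAt R (x s * xd s / R s) s := by
        refine ((((hxd s).pow 2).sub_const 1).sqrt (hR2 s hs).ne').congr_deriv ?_
        simp only [R]
        have : Real.sqrt (x s ^ 2 - 1) ≠ 0 := hRp'.ne'
        simp
        field_simp
      have hgd := hwd.div (hRd.const_mul khat) (mul_pos hk hRp').ne'
      refine (hgd.smul (hyd s)).congr_deriv ?_
      simp only [Pi.div_apply]
      rw [add_comm]
      congr 2
      field_simp)
    (by
      intro s hs
      exact cone_speed (hyh s) (herm_comb hU hV _ _) (hx1 s hs) (t1 s) (t2 s) (t3 s)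
        (Real.arcosh_pos (hx1 s hs)) (hRp s hs) (hRs s hs) (Real.sinh_arcosh (hx1 s hs).le) rfl)
  have C0 : C 0 = (b / khat) • U := by
    have x0 : x 0 = Real.cosh b := by simp [x, p, q, hsa.ne']
    have y0 : y 0 = Real.sinh b • U := by simp [y, p, q, hsa.ne']
    have w0 : w 0 = b := by simp only [w]; rw [x0, Real.arcosh_cosh hb.le]
    have R0 : R 0 = Real.sinh b := by
      simp only [R]; rw [x0, eb]; simp [Real.sqrt_sq hsb.le]
    simp only [C]
    rw [y0, w0, R0, smul_smul]
    congr 1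
    field_simp
  have C1 : C a = (c / khat) • V := by
    have x0 : x a = Real.cosh c := by simp [x, p, q, hsa.ne']
    have y0 : y a = Real.sinh c • V := by simp [y, p, q, hsa.ne']
    have w0 : w a = c := by simp only [w]; rw [x0, Real.arcosh_cosh hc.le]
    have R0 : R a = Real.sinh c := by
      simp only [R]; rw [x0, ec]; simp [Real.sqrt_sq hsc.le]
    simp only [C]
    rw [y0, w0, R0, smul_smul]
    congr 1
    field_simp
  rwa [C0, C1] at main

end
end SPDAux

namespace SPDAux
section
open SPD
open scoped Matrix.Norms.Frobenius
open scoped Topology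

variable {n : ℕ}

theorem loc_dep {M : Matrix (Fin n) (Fin n) ℝ} (hM : M.IsHermitian) (a b : ℝ) {ζ : ℝ}
    (hζ : 1 ≤ ζ) : dR (NormedSpace.exp (b • M)) (NormedSpace.exp (a • M)) ^ 2
      ≤ ‖a • M‖ ^ 2 + ζ * ‖b • M‖ ^ 2 - 2 * ((a • M) * (b • M)).trace := by
  set K := NormedSpace.exp ((b / 2) • M) with hK
  have hKp : K.PosDef := posDef_exp (herm_smul hM _)
  have hKt : Kᵀ = K := isHermitian_iff_transpose.1 hKp.1
  have h1 := dR_factor hKp.isUnit (posDef_exp (herm_smul hM (a - b)))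
  rw [lg_exp (herm_smul hM _), hKt, hK, ← exp_smul_add, ← exp_smul_add, ← exp_smul_add] at h1
  have e1 : b / 2 + b / 2 = b := by ring
  have e2 : b / 2 + (a - b) + b / 2 = a := by ring
  rw [e1, e2] at h1
  have h2 : ((a • M) * (b • M)).trace = a * b * ‖M‖ ^ 2 := by
    rw [norm_sq_herm hM, Matrix.smul_mul, Matrix.mul_smul, trace_smul, trace_smul]
    simp only [smul_eq_mul]; ring
  rw [h1, h2, norm_smul, norm_smul, norm_smul, mul_pow, mul_pow, mul_pow]
  simp only [Real.norm_eq_abs, sq_abs]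
  nlinarith [mul_nonneg (sub_nonneg.2 hζ) (mul_nonneg (sq_nonneg b) (sq_nonneg ‖M‖))]

theorem loc {A B : Matrix (Fin n) (Fin n) ℝ} (hA : A.IsHermitian) (hB : B.IsHermitian) {ζ : ℝ}
    (hζ : 1 ≤ ζ) (hζ2 : 0 < ‖A‖ → zt (khat * ‖A‖) ≤ ζ) :
    dR (NormedSpace.exp B) (NormedSpace.exp A) ^ 2
      ≤ ‖A‖ ^ 2 + ζ * ‖B‖ ^ 2 - 2 * (A * B).trace := by
  have hk := khat_pos
  by_cases hA0 : A = 0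
  · have := loc_dep hB 0 1 hζ
    rw [one_smul, zero_smul, ← hA0] at this
    exact this
  by_cases hB0 : B = 0
  · have := loc_dep hA 1 0 hζ
    rw [one_smul, zero_smul, ← hB0] at this
    exact this
  have nA : 0 < ‖A‖ := norm_pos_iff.2 hA0
  have nB : 0 < ‖B‖ := norm_pos_iff.2 hB0
  set U := ‖B‖⁻¹ • B with hU
  set V := ‖A‖⁻¹ • A with hV
  have hUh : U.IsHermitian := herm_smul hB _
  have hVh : V.IsHermitian := herm_smul hA _
  have hBU : B = ‖B‖ • U := by rw [hU, smul_smul, mul_inv_cancel₀ nB.ne', one_smul]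
  have hAV : A = ‖A‖ • V := by rw [hV, smul_smul, mul_inv_cancel₀ nA.ne', one_smul]
  have hU1 : (U * U).trace = 1 := by
    rw [← norm_sq_herm hUh, hU, norm_smul, norm_inv, norm_norm, inv_mul_cancel₀ nB.ne', one_pow]
  have hV1 : (V * V).trace = 1 := by
    rw [← norm_sq_herm hVh, hV, norm_smul, norm_inv, norm_norm, inv_mul_cancel₀ nA.ne', one_pow]
  obtain ⟨u, hu⟩ : ∃ u, (U * V).trace = u := ⟨_, rfl⟩
  have hn : ‖(1 : ℝ) • U + (-u) • V‖ ^ 2 = 1 - u ^ 2 := by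
    rw [norm_sq_herm (herm_comb hUh hVh _ _), trace_comb, hU1, hV1, hu]; ring
  have hu1 : u ^ 2 ≤ 1 := by nlinarith [sq_nonneg ‖(1 : ℝ) • U + (-u) • V‖]
  rcases hu1.eq_or_lt with h | h
  · have h0 : (1 : ℝ) • U + (-u) • V = 0 := by
      rw [h, sub_self] at hn
      exact norm_eq_zero.1 (pow_eq_zero_iff two_ne_zero |>.1 hn)
    have hUV : U = u • V := by
      rw [one_smul, neg_smul] at h0
      exact add_neg_eq_zero.1 h0
    have := loc_dep hVh ‖A‖ (‖B‖ * u) hζ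
    rw [← smul_smul, ← hUV, ← hBU, ← hAV] at this
    exact this
  · have hb : 0 < khat * ‖B‖ := mul_pos hk nB
    have hc : 0 < khat * ‖A‖ := mul_pos hk nA
    set b := khat * ‖B‖ with hbd
    set c := khat * ‖A‖ with hcd
    have hsb := sinh_pos hb
    have hsc := sinh_pos hc
    have hul : u < 1 := by nlinarith
    have hgt : 1 < Real.cosh b * Real.cosh c - Real.sinh b * Real.sinh c * u := by
      have h1 := Real.one_le_cosh (b - c)
      rw [Real.cosh_sub] at h1
      nlinarith [mul_pos (mul_pos hsb hsc) (sub_pos.2 hul)]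
    have hd := hyp_dist hUh hVh hU1 hV1 hu h hb hc (Real.arcosh_pos hgt)
      (Real.cosh_arcosh hgt.le)
    have eb : b / khat = ‖B‖ := by rw [hbd]; field_simp
    have ec : c / khat = ‖A‖ := by rw [hcd]; field_simp
    rw [eb, ec, ← hBU, ← hAV] at hd
    set a := Real.arcosh (Real.cosh b * Real.cosh c - Real.sinh b * Real.sinh c * u) with had
    obtain ⟨hy, hm⟩ := scalar_main hb.le hc hu1
    rw [← Real.cosh_arcosh hgt.le, ← had, Real.cosh_le_cosh, abs_of_nonneg (Real.sqrt_nonneg _)] at hm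
    have ha0 : 0 ≤ a := Real.arcosh_nonneg hgt.le
    rw [abs_of_nonneg ha0] at hm
    have ha2 : a ^ 2 ≤ c ^ 2 + zt c * b ^ 2 - 2 * b * c * u := by
      rw [← Real.sq_sqrt hy.le]
      exact pow_le_pow_left₀ ha0 hm 2
    have hd2 : dR (NormedSpace.exp B) (NormedSpace.exp A) ^ 2 ≤ (khat⁻¹ * a) ^ 2 :=
      pow_le_pow_left₀ (dR_nonneg _ _) hd 2
    have htr : (A * B).trace = ‖A‖ * ‖B‖ * u := by
      rw [trace_mul_comm]
      conv_lhs => rw [hBU, hAV]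
      rw [Matrix.smul_mul, Matrix.mul_smul, trace_smul, trace_smul, hu]
      simp only [smul_eq_mul]; ring
    have h5 : (khat⁻¹ * a) ^ 2 ≤ khat⁻¹ ^ 2 * (c ^ 2 + zt c * b ^ 2 - 2 * b * c * u) := by
      rw [mul_pow]
      exact mul_le_mul_of_nonneg_left ha2 (by positivity)
    have h6 : khat⁻¹ ^ 2 * (c ^ 2 + zt c * b ^ 2 - 2 * b * c * u)
        = ‖A‖ ^ 2 + zt c * ‖B‖ ^ 2 - 2 * (‖A‖ * ‖B‖ * u) := by
      rw [hbd, hcd]; field_simp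
    rw [htr]
    have h7 := mul_le_mul_of_nonneg_right (hζ2 nA) (sq_nonneg ‖B‖)
    linarith

theorem trace_cs {A B : Matrix (Fin n) (Fin n) ℝ} (hA : A.IsHermitian) (hB : B.IsHermitian) :
    |(A * B).trace| ≤ ‖A‖ * ‖B‖ := by
  apply abs_le_of_sq_le_sq _ (by positivity)
  have h : ∀ a b : ℝ, 0 ≤ a * a * ‖A‖ ^ 2 + (a * b + b * a) * (A * B).trace + b * b * ‖B‖ ^ 2 := by
    intro a b
    rw [norm_sq_herm hA, norm_sq_herm hB, ← trace_comb, ← norm_sq_herm (herm_comb hA hB _ _)]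
    positivity
  rw [mul_pow]
  rcases eq_or_ne B 0 with h0 | h0
  · simp [h0]
  · have nB : 0 < ‖B‖ ^ 2 := pow_pos (norm_pos_iff.2 h0) 2
    have := h (‖B‖ ^ 2) (-(A * B).trace)
    by_contra! hc
    nlinarith [mul_lt_mul_of_pos_right hc nB]

end
end SPDAux

namespace SPDAux
section
open SPD
open scoped Matrix.Norms.Frobenius
open scoped Topology

variable {n : ℕ}

/-- Whitened tangent vector. -/
noncomputable def hat (p v : Matrix (Fin n) (Fin n) ℝ) : Matrix (Fin n) (Fin n) ℝ :=
  (msqrt p)⁻¹ * v * (msqrt p)⁻¹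

theorem hat_add (p v w : Matrix (Fin n) (Fin n) ℝ) : hat p (v + w) = hat p v + hat p w := by
  simp [hat, Matrix.mul_add, Matrix.add_mul]

theorem hat_smul (p v : Matrix (Fin n) (Fin n) ℝ) (c : ℝ) : hat p (c • v) = c • hat p v := by
  simp [hat]

theorem msqrt_inv_herm {p : Matrix (Fin n) (Fin n) ℝ} (hp : p.PosDef) :
    ((msqrt p)⁻¹)ᵀ = (msqrt p)⁻¹ :=
  isHermitian_iff_transpose.1 (msqrt_props hp).1.inv.1

theorem msqrt_det {p : Matrix (Fin n) (Fin n) ℝ} (hp : p.PosDef) : IsUnit (msqrt p).det :=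
  (Matrix.isUnit_iff_isUnit_det _).1 (msqrt_props hp).1.isUnit

theorem hat_herm {p v : Matrix (Fin n) (Fin n) ℝ} (hp : p.PosDef) (hv : v.IsHermitian) :
    (hat p v).IsHermitian := by
  have := herm_conj (msqrt p)⁻¹ hv
  rwa [msqrt_inv_herm hp] at this

theorem hat_cancel {p : Matrix (Fin n) (Fin n) ℝ} (hp : p.PosDef) (M : Matrix (Fin n) (Fin n) ℝ) :
    hat p (msqrt p * M * msqrt p) = M := by
  have h := msqrt_det hp
  unfold hat
  have : (msqrt p)⁻¹ * (msqrt p * M * msqrt p) * (msqrt p)⁻¹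
      = ((msqrt p)⁻¹ * msqrt p) * M * (msqrt p * (msqrt p)⁻¹) := by simp only [Matrix.mul_assoc]
  rw [this, Matrix.nonsing_inv_mul _ h, Matrix.mul_nonsing_inv _ h, Matrix.one_mul, Matrix.mul_one]

theorem hat_cancel' {p : Matrix (Fin n) (Fin n) ℝ} (hp : p.PosDef)
    (M : Matrix (Fin n) (Fin n) ℝ) : msqrt p * hat p M * msqrt p = M := by
  have h := msqrt_det hp
  unfold hat
  have : msqrt p * ((msqrt p)⁻¹ * M * (msqrt p)⁻¹) * msqrt p
      = (msqrt p * (msqrt p)⁻¹) * M * ((msqrt p)⁻¹ * msqrt p) := by simp only [Matrix.mul_assoc]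
  rw [this, Matrix.nonsing_inv_mul _ h, Matrix.mul_nonsing_inv _ h, Matrix.one_mul, Matrix.mul_one]

theorem minner_eq {p : Matrix (Fin n) (Fin n) ℝ} (hp : p.PosDef) (v w : Matrix (Fin n) (Fin n) ℝ) :
    minner p v w = (hat p v * hat p w).trace := by
  have e : p⁻¹ = (msqrt p)⁻¹ * (msqrt p)⁻¹ := by
    rw [← Matrix.mul_inv_rev, (msqrt_props hp).2]
  unfold minner hat
  rw [e, Matrix.mul_assoc, Matrix.mul_assoc, Matrix.mul_assoc, trace_mul_comm]
  simp only [Matrix.mul_assoc]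

theorem mnorm_eq {p v : Matrix (Fin n) (Fin n) ℝ} (hp : p.PosDef) (hv : v.IsHermitian) :
    mnorm p v = ‖hat p v‖ := by
  unfold mnorm
  rw [minner_eq hp, ← norm_sq_herm (hat_herm hp hv), Real.sqrt_sq (norm_nonneg _)]

theorem hat_mlogP {p : Matrix (Fin n) (Fin n) ℝ} (hp : p.PosDef) (q : Matrix (Fin n) (Fin n) ℝ) :
    hat p (mlogP p q) = lg (hat p q) := hat_cancel hp _

theorem mexpP_eq {p v : Matrix (Fin n) (Fin n) ℝ} (hp : p.PosDef) (hv : v.IsHermitian) :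
    mexpP p v = msqrt p * NormedSpace.exp (hat p v) * msqrt p := by
  unfold mexpP
  have := mfun_exp (hat_herm hp hv)
  unfold hat at this ⊢
  rw [this]

theorem posDef_mexp {p R : Matrix (Fin n) (Fin n) ℝ} (hp : p.PosDef) (hR : R.IsHermitian) :
    (msqrt p * NormedSpace.exp R * msqrt p).PosDef := by
  have := posDef_conj (posDef_exp hR) (msqrt_props hp).1.isUnit
  rwa [isHermitian_iff_transpose.1 (msqrt_props hp).1.1] at this

theorem hat_posDef {p q : Matrix (Fin n) (Fin n) ℝ} (hp : p.PosDef) (hq : q.PosDef) :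
    (hat p q).PosDef := by
  have := posDef_conj hq (msqrt_props hp).1.inv.isUnit
  rwa [msqrt_inv_herm hp] at this

theorem gstep {p q w : Matrix (Fin n) (Fin n) ℝ} (hp : p.PosDef) (hq : q.PosDef)
    (hw : w.IsHermitian) {D : ℝ} (hD : 0 < D) (hd : dR p q ≤ D) :
    dR (mexpP p w) q ^ 2 ≤ dR p q ^ 2 + zt (khat * D) * ‖hat p w‖ ^ 2
      - 2 * (lg (hat p q) * hat p w).trace := by
  have hk := khat_pos
  have hA : (lg (hat p q)).IsHermitian := lg_herm (hat_posDef hp hq)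
  have hq' : q = msqrt p * NormedSpace.exp (lg (hat p q)) * msqrt p := (coords hp hq).1
  have hdn : dR p q = ‖lg (hat p q)‖ := dR_eq hp hq
  have e : dR (mexpP p w) q
      = dR (NormedSpace.exp (hat p w)) (NormedSpace.exp (lg (hat p q))) := by
    rw [mexpP_eq hp hw]
    conv_lhs => rw [hq']
    exact dR_conj_exp (msqrt_props hp).1 (hat_herm hp hw) hA
  rw [e, hdn]
  rw [hdn] at hd
  exact loc hA (hat_herm hp hw) (one_lt_zt (mul_pos hk hD)).le
    (fun h => zt_mono (mul_pos hk h) (mul_le_mul_of_nonneg_left hd hk.le))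

theorem nonpos_of_small {τ B : ℝ} (hB : 0 ≤ B)
    (h : ∀ θ ∈ Set.Ioc (0 : ℝ) 1, 2 * τ ≤ B * θ) : τ ≤ 0 := by
  by_contra! hτ
  have hpos : 0 < min 1 (τ / (B + 1)) := lt_min one_pos (by positivity)
  have h1 := h (min 1 (τ / (B + 1))) ⟨hpos, min_le_left _ _⟩
  have h2 : min 1 (τ / (B + 1)) ≤ τ / (B + 1) := min_le_right _ _
  have h3 : B * min 1 (τ / (B + 1)) ≤ B * (τ / (B + 1)) := mul_le_mul_of_nonneg_left h2 hB
  have h4 : B * (τ / (B + 1)) ≤ τ := by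
    rw [← mul_div_assoc, div_le_iff₀ (by linarith)]; nlinarith
  linarith

theorem proj_le {X : Set (Matrix (Fin n) (Fin n) ℝ)} (hXpos : ∀ x ∈ X, x.PosDef)
    (hXconv : GConvexSet X) {r p q : Matrix (Fin n) (Fin n) ℝ} (hr : r.PosDef) (hpX : p ∈ X)
    (hqX : q ∈ X) (hnear : ∀ q ∈ X, dR r p ≤ dR r q) : dR p q ≤ dR r q := by
  have hp := hXpos p hpX
  have hq := hXpos q hqX
  have hG := (msqrt_props hp).1
  set R := lg (hat p r) with hR
  set Q := lg (hat p q) with hQ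
  have hRh : R.IsHermitian := lg_herm (hat_posDef hp hr)
  have hQh : Q.IsHermitian := lg_herm (hat_posDef hp hq)
  have hr' : r = msqrt p * NormedSpace.exp R * msqrt p := (coords hp hr).1
  have hq' : q = msqrt p * NormedSpace.exp Q * msqrt p := (coords hp hq).1
  have hdr : dR r p = ‖R‖ := by rw [dR_symm hr hp]; exact dR_eq hp hr
  have hdq : dR p q = ‖Q‖ := dR_eq hp hq
  have hgm : ∀ θ : ℝ, gmean θ p q = msqrt p * NormedSpace.exp (θ • Q) * msqrt p := by
    intro θ
    unfold gmean
    have := mfun_rpow (hat_posDef hp hq) θ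
    rw [← hQ] at this
    rw [← this]
    rfl
  clear_value R Q
  obtain ⟨ζ, hζ1, hζ2⟩ : ∃ ζ : ℝ, 1 ≤ ζ ∧ zt (khat * ‖R‖) ≤ ζ :=
    ⟨max 1 (zt (khat * ‖R‖)), le_max_left _ _, le_max_right _ _⟩
  have key : ∀ θ ∈ Set.Ioc (0 : ℝ) 1, 2 * (R * Q).trace ≤ (ζ * ‖Q‖ ^ 2) * θ := by
    intro θ hθ
    have h1 := hnear _ (hXconv p hpX q hqX θ ⟨hθ.1.le, hθ.2⟩)
    have h2 := hgm θ
    have h3 : dR r (gmean θ p q) = dR (NormedSpace.exp (θ • Q)) (NormedSpace.exp R) := by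
      rw [h2]
      conv_lhs => rw [hr']
      rw [dR_conj_exp hG hRh (herm_smul hQh _), dR_symm (posDef_exp hRh)
        (posDef_exp (herm_smul hQh _))]
    have h4 := loc hRh (herm_smul hQh θ) hζ1 (fun _ => hζ2)
    rw [← h3, Matrix.mul_smul, trace_smul, norm_smul, mul_pow, Real.norm_eq_abs, sq_abs,
      smul_eq_mul] at h4
    rw [hdr] at h1
    have h5 := pow_le_pow_left₀ (norm_nonneg _) h1 2
    have h6 : θ * (2 * (R * Q).trace) ≤ θ * ((ζ * ‖Q‖ ^ 2) * θ) := by linarith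
    exact le_of_mul_le_mul_left h6 hθ.1
  have htr : (R * Q).trace ≤ 0 := nonpos_of_small (by positivity) key
  have h7 := emi_exp hRh hQh
  rw [← dR_conj_exp hG hRh hQh, ← hr', ← hq'] at h7
  rw [hdq]
  refine le_trans ?_ h7
  refine abs_le_of_sq_le_sq' ?_ (norm_nonneg _) |>.2
  have h8 : ‖Q - R‖ ^ 2 = ‖R‖ ^ 2 - 2 * (R * Q).trace + ‖Q‖ ^ 2 := by
    have e : Q - R = (-1 : ℝ) • R + (1 : ℝ) • Q := by simp [sub_eq_add_neg, add_comm]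
    rw [e, norm_sq_herm (herm_comb hRh hQh _ _), trace_comb, norm_sq_herm hRh, norm_sq_herm hQh]
    ring
  rw [h8]
  nlinarith [sq_nonneg ‖R‖]

theorem final_bound {f : Matrix (Fin n) (Fin n) ℝ → ℝ}
    {X : Set (Matrix (Fin n) (Fin n) ℝ)} (hXpos : ∀ x ∈ X, x.PosDef)
    (hXconv : GConvexSet X)
    {D : ℝ} (hD : 0 < D) (hdiam : ∀ p ∈ X, ∀ q ∈ X, dR p q ≤ D)
    {ε : ℝ} {α : ℝ} (hα0 : 0 < α)
    {p s u : ℕ → Matrix (Fin n) (Fin n) ℝ} {t : ℕ → ℝ}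
    (htdef : ∀ k, t k = α * (f (p k) - sInf (f '' X) - ε * D) / mnorm (p k) (s k + u k))
    (hit : Iter f X p s u t)
    {ι : ℝ} {N : ℕ}
    (hu : ∀ k < N, mnorm (p k) (u k) ≤ ε) (hs : ∀ k < N, mnorm (p k) (s k) ≤ ι)
    (htn : ∀ k < N, 0 ≤ t k) :
    (∀ k < N, 0 ≤ f (p k) - sInf (f '' X) - ε * D ∧ 0 < mnorm (p k) (s k + u k) ∧
      mnorm (p k) (s k + u k) ≤ ε + ι) ∧
    ∑ k ∈ Finset.range N, (2 * α - zt (khat * D) * α ^ 2) *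
      ((f (p k) - sInf (f '' X) - ε * D) / mnorm (p k) (s k + u k)) ^ 2 ≤ D ^ 2 := by
  have hpX : ∀ k, p k ∈ X := by
    intro k
    cases k with
    | zero => exact hit.p0_mem
    | succ k => exact hit.proj_mem k
  have hpp : ∀ k, (p k).PosDef := fun k => hXpos _ (hpX k)
  have hsh : ∀ k, (s k).IsHermitian := fun k => (hit.subgrad k).1
  have hvh : ∀ k, (s k + u k).IsHermitian := fun k => (hsh k).add (hit.u_herm k)
  have hsub : ∀ k, ∀ q ∈ X, f (p k) + (hat (p k) (s k) * lg (hat (p k) q)).trace ≤ f q := by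
    intro k q hq
    have := (hit.subgrad k).2 q (hXpos q hq)
    rwa [minner_eq (hpp k), hat_mlogP (hpp k)] at this
  have hlgD : ∀ k, ∀ q ∈ X, ‖lg (hat (p k) q)‖ ≤ D := by
    intro k q hq
    have := hdiam _ (hpX k) q hq
    rwa [dR_eq (hpp k) (hXpos q hq)] at this
  have hlgh : ∀ k, ∀ q ∈ X, (lg (hat (p k) q)).IsHermitian := fun k q hq =>
    lg_herm (hat_posDef (hpp k) (hXpos q hq))
  set fs := sInf (f '' X) with hfs
  have hV : ∀ k, mnorm (p k) (s k + u k) = ‖hat (p k) (s k + u k)‖ := fun k =>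
    mnorm_eq (hpp k) (hvh k)
  have hVpos : ∀ k, 0 < mnorm (p k) (s k + u k) := by
    intro k
    rw [hV]
    apply norm_pos_iff.2
    intro h0
    have := hat_cancel' (hpp k) (s k + u k)
    rw [h0, Matrix.mul_zero, Matrix.zero_mul] at this
    exact hit.v_ne k this.symm
  let g : ℕ → ℝ := fun k => f (p k) - fs - ε * D
  let V : ℕ → ℝ := fun k => mnorm (p k) (s k + u k)
  have hg : ∀ k < N, 0 ≤ g k := by
    intro k hk
    have h1 := htn k hk
    rw [htdef] at h1
    have h2 : 0 ≤ α * g k := by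
      by_contra! hc
      exact absurd (div_neg_of_neg_of_pos hc (hVpos k)) (not_lt.2 h1)
    exact nonneg_of_mul_nonneg_right h2 hα0
  refine ⟨fun k hk => ⟨hg k hk, hVpos k, ?_⟩, ?_⟩
  · rw [hV, hat_add]
    have h1 := norm_add_le (hat (p k) (s k)) (hat (p k) (u k))
    rw [← mnorm_eq (hpp k) (hsh k), ← mnorm_eq (hpp k) (hit.u_herm k)] at h1
    linarith [hu k hk, hs k hk]
  set ζ := zt (khat * D) with hζ
  -- one step
  have step : ∀ δ > 0, ∀ q ∈ X, f q < fs + δ → ∀ k < N,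
      (2 * α - ζ * α ^ 2) * (g k / V k) ^ 2
        ≤ (dR (p k) q ^ 2 - dR (p (k + 1)) q ^ 2) + δ * (2 * α * (g k / V k ^ 2)) := by
    intro δ hδ q hq hfq k hk
    have hVk : 0 < V k := hVpos k
    have hwh : (-(t k / mnorm (p k) (s k + u k)) • (s k + u k)).IsHermitian := herm_smul (hvh k) _
    have hr : (mexpP (p k) (-(t k / mnorm (p k) (s k + u k)) • (s k + u k))).PosDef := by
      rw [mexpP_eq (hpp k) hwh]
      exact posDef_mexp (hpp k) (hat_herm (hpp k) hwh)
    have h1 := proj_le hXpos hXconv hr (hpX (k + 1)) hq (hit.proj_nearest k)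
    have h2 := gstep (hpp k) (hXpos q hq) hwh hD (hdiam _ (hpX k) q hq)
    have h3 := pow_le_pow_left₀ (dR_nonneg _ _) h1 2
    rw [hat_smul, norm_smul, ← hV, Matrix.mul_smul, trace_smul, smul_eq_mul, mul_pow,
      Real.norm_eq_abs, sq_abs, ← hζ] at h2
    have htk : t k = α * g k / V k := htdef k
    have hVd : mnorm (p k) (s k + u k) = V k := rfl
    rw [hVd] at h1 h2 h3
    have htr : (lg (hat (p k) q) * hat (p k) (s k + u k)).trace ≤ δ - g k := by
      rw [hat_add, Matrix.mul_add, trace_add, trace_mul_comm]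
      have a1 := hsub k q hq
      have a2 := (abs_le.1 (trace_cs (hlgh k q hq) (hat_herm (hpp k) (hit.u_herm k)))).2
      have a3 : ‖lg (hat (p k) q)‖ * ‖hat (p k) (u k)‖ ≤ D * ε := by
        have := hu k hk
        rw [mnorm_eq (hpp k) (hit.u_herm k)] at this
        exact mul_le_mul (hlgD k q hq) this (norm_nonneg _) hD.le
      simp only [g]
      linarith
    have hτ : 0 ≤ t k / V k := div_nonneg (htn k hk) hVk.le
    have a4 := mul_le_mul_of_nonneg_left htr hτ
    have e1 : ζ * ((-(t k / V k)) ^ 2 * V k ^ 2) = ζ * α ^ 2 * (g k / V k) ^ 2 := by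
      rw [htk]; field_simp
    have e2 : t k / V k * (δ - g k) = α * (δ * (g k / V k ^ 2)) - α * (g k / V k) ^ 2 := by
      rw [htk]; field_simp
    rw [e1] at h2
    rw [e2] at a4
    linarith
  set S := ∑ k ∈ Finset.range N, 2 * α * (g k / V k ^ 2) with hS
  have hS0 : 0 ≤ S := Finset.sum_nonneg fun k hk => by
    have := hg k (Finset.mem_range.1 hk)
    positivity
  apply le_of_forall_pos_le_add
  intro e he
  have hδ : 0 < e / (S + 1) := by positivity
  have hne : (f '' X).Nonempty := ⟨_, p 0, hpX 0, rfl⟩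
  obtain ⟨_, ⟨q, hq, rfl⟩, hfq⟩ := exists_lt_of_csInf_lt hne
    (show sInf (f '' X) < fs + e / (S + 1) by rw [← hfs]; linarith)
  have h1 := Finset.sum_le_sum fun k hk => step _ hδ q hq hfq k (Finset.mem_range.1 hk)
  rw [Finset.sum_add_distrib, Finset.sum_range_sub', ← Finset.mul_sum (f := fun k => 2 * α * (g k / V k ^ 2)), ← hS] at h1
  have h2 : e / (S + 1) * S ≤ e := by
    rw [div_mul_eq_mul_div, div_le_iff₀ (by linarith)]; nlinarith
  have h3 := pow_le_pow_left₀ (dR_nonneg _ _) (hdiam _ (hpX 0) q hq) 2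
  have h4 := sq_nonneg (dR (p N) q)
  linarith

end
end SPDAux

open SPD

/-- Complexity bound for the inexact projected subgradient method with Polyak
step sizes `t_k = α(f(p_k) − f* − εD)/‖v_k‖`, where `κ̂ = 1/√2` and
`Γ = (2α − (κ̂D/tanh(κ̂D))α²)/((ε+ι)²D²)`. -/
theorem complexity_polyak {n : ℕ}
    (f : Matrix (Fin n) (Fin n) ℝ → ℝ) (hf : GConvexFun f)
    (X : Set (Matrix (Fin n) (Fin n) ℝ)) (hXpos : ∀ x ∈ X, x.PosDef)
    (hXne : X.Nonempty) (hXcpt : IsCompact X) (hXconv : GConvexSet X)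
    (D : ℝ) (hD : 0 < D) (hdiam : ∀ p ∈ X, ∀ q ∈ X, dR p q ≤ D)
    (ε : ℝ) (hε : 0 < ε)
    (α : ℝ) (hα0 : 0 < α) (hα : α < 2 * Real.tanh (khat * D) / (khat * D))
    (p s u : ℕ → Matrix (Fin n) (Fin n) ℝ) (t : ℕ → ℝ)
    (htdef : ∀ k, t k = α * (f (p k) - sInf (f '' X) - ε * D) / mnorm (p k) (s k + u k))
    (hit : Iter f X p s u t)
    (ι : ℝ) (hι : 0 < ι) (N : ℕ) (hN : 0 < N)
    (hu : ∀ k < N, mnorm (p k) (u k) ≤ ε) (hs : ∀ k < N, mnorm (p k) (s k) ≤ ι)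
    (htn : ∀ k < N, 0 ≤ t k) :
    (Finset.range N).inf' (Finset.nonempty_range_iff.mpr (by omega))
        (fun k => f (p k) - (sInf (f '' X) + ε * D))
      ≤ 1 / (Real.sqrt ((2 * α - (khat * D / Real.tanh (khat * D)) * α ^ 2)
              / ((ε + ι) ^ 2 * D ^ 2)) * Real.sqrt N) := by
  have hk : 0 < khat * D := mul_pos SPDAux.khat_pos hD
  have hsh := SPDAux.sinh_pos hk
  have hch := Real.cosh_pos (khat * D)
  have hz : khat * D / Real.tanh (khat * D) = SPDAux.zt (khat * D) := by
    rw [Real.tanh_eq_sinh_div_cosh, SPDAux.zt]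
    field_simp
  have hβ : 0 < 2 * α - SPDAux.zt (khat * D) * α ^ 2 := by
    rw [Real.tanh_eq_sinh_div_cosh, lt_div_iff₀ hk] at hα
    have h1 : SPDAux.zt (khat * D) * α < 2 := by
      rw [SPDAux.zt, div_mul_eq_mul_div, div_lt_iff₀ hsh]
      have h2 := mul_lt_mul_of_pos_right hα hch
      have h3 : 2 * (Real.sinh (khat * D) / Real.cosh (khat * D)) * Real.cosh (khat * D)
          = 2 * Real.sinh (khat * D) := by field_simp
      linarith
    nlinarith
  obtain ⟨h1, h2⟩ := SPDAux.final_bound hXpos hXconv hD hdiam hα0 htdef hit hu hs htn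
  rw [hz]
  set β := 2 * α - SPDAux.zt (khat * D) * α ^ 2 with hβd
  set m := (Finset.range N).inf' (Finset.nonempty_range_iff.mpr (by omega))
        (fun k => f (p k) - (sInf (f '' X) + ε * D)) with hm
  have hN' : (0 : ℝ) < N := Nat.cast_pos.2 hN
  have hΓ : 0 < β / ((ε + ι) ^ 2 * D ^ 2) := by positivity
  rcases le_total m 0 with hm0 | hm0
  · exact hm0.trans (by positivity)
  have hmk : ∀ k < N, m ≤ f (p k) - sInf (f '' X) - ε * D := by
    intro k hk
    have : m ≤ f (p k) - (sInf (f '' X) + ε * D) :=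
      Finset.inf'_le _ (Finset.mem_range.2 hk)
    linarith
  have h3 : ∑ k ∈ Finset.range N, β * (m / (ε + ι)) ^ 2 ≤ D ^ 2 := by
    refine (Finset.sum_le_sum fun k hk => ?_).trans h2
    have hk' := Finset.mem_range.1 hk
    obtain ⟨a1, a2, a3⟩ := h1 k hk'
    refine mul_le_mul_of_nonneg_left ?_ hβ.le
    exact pow_le_pow_left₀ (by positivity) (div_le_div₀ a1 (hmk k hk') a2 a3) 2
  rw [Finset.sum_const, Finset.card_range, nsmul_eq_mul] at h3
  rw [le_div_iff₀ (by positivity)]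
  refine abs_le_of_sq_le_sq' ?_ zero_le_one |>.2
  rw [mul_pow, mul_pow, Real.sq_sqrt hΓ.le, Real.sq_sqrt hN'.le]
  have h4 : m ^ 2 * (β / ((ε + ι) ^ 2 * D ^ 2) * N)
      = (N * (β * (m / (ε + ι)) ^ 2)) / D ^ 2 := by field_simp
  rw [h4, one_pow, div_le_one (by positivity)]
  exact h3
end

section
/- (Geodesic convexity of singular value sums.) Let A be an invertible real n×n matrix, let p, q, P, Q ∈ S⁺_n, let θ ∈ [0,1] and k ∈ {1,…,n}. Then ∑_{i=1}^k ln α_i( (P #_θ Q)^{1/2} A (p #_θ q)^{-1/2} ) ≤ (1−θ)·∑_{i=1}^k ln α_i( P^{1/2} A p^{-1/2} ) + θ·∑_{i=1}^k ln α_i( Q^{1/2} A q^{-1/2} ). -/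
open Matrix Real Filter

open SPD

/-- Symmetrized Cauchy-Binet formula. -/
lemma cauchyBinet_sym {n k : ℕ} (X Y : Matrix (Fin n) (Fin k) ℝ) :
    (k.factorial : ℝ) * (Xᵀ * Y).det
      = ∑ f : Fin k → Fin n, (X.submatrix f id).det * (Y.submatrix f id).det := by
  have h1 : (Xᵀ * Y).det = ∑ f : Fin k → Fin n, (∏ i, Y (f i) i) * (X.submatrix f id).det := by
    rw [det_apply']
    simp only [mul_apply, Finset.prod_univ_sum, Finset.mul_sum, Fintype.piFinset_univ]
    rw [Finset.sum_comm]
    refine Finset.sum_congr rfl fun f _ => ?_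
    rw [← det_transpose, det_apply', Finset.mul_sum]
    refine Finset.sum_congr rfl fun σ _ => ?_
    simp only [transpose_apply, submatrix_apply, id, Finset.prod_mul_distrib]
    ring
  have h2 : ∀ σ : Equiv.Perm (Fin k), (Xᵀ * Y).det
      = ∑ f : Fin k → Fin n, ((Equiv.Perm.sign σ : ℤ) : ℝ) * (∏ i, Y (f (σ i)) i)
          * (X.submatrix f id).det := by
    intro σ
    rw [h1]
    symm
    refine Fintype.sum_equiv (Equiv.arrowCongr σ.symm (Equiv.refl (Fin n))) _ _ fun f => ?_
    have : X.submatrix ((Equiv.arrowCongr σ.symm (Equiv.refl (Fin n))) f) id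
        = (X.submatrix f id).submatrix σ id := by
      ext i j; simp
    rw [this, det_permute]
    simp
    ring
  have h3 : (k.factorial : ℝ) * (Xᵀ * Y).det = ∑ σ : Equiv.Perm (Fin k), (Xᵀ * Y).det := by
    simp [Fintype.card_perm]
  rw [h3, Finset.sum_congr rfl (fun σ _ => h2 σ), Finset.sum_comm]
  refine Finset.sum_congr rfl fun f _ => ?_
  rw [det_apply' (Y.submatrix f id), Finset.mul_sum]
  refine Finset.sum_congr rfl fun σ _ => ?_
  simp only [submatrix_apply, id]
  ring

lemma det_cs {n k : ℕ} (X Y : Matrix (Fin n) (Fin k) ℝ) :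
    (Xᵀ * Y).det ^ 2 ≤ (Xᵀ * X).det * (Yᵀ * Y).det := by
  have h := Finset.sum_mul_sq_le_sq_mul_sq Finset.univ
    (fun f : Fin k → Fin n => (X.submatrix f id).det) (fun f => (Y.submatrix f id).det)
  simp only [sq (det (submatrix _ _ _))] at h
  rw [← cauchyBinet_sym, ← cauchyBinet_sym, ← cauchyBinet_sym] at h
  have hk : (0:ℝ) < k.factorial := by exact_mod_cast k.factorial_pos
  have h' : (k.factorial : ℝ)^2 * (Xᵀ * Y).det ^ 2
      ≤ (k.factorial : ℝ)^2 * ((Xᵀ * X).det * (Yᵀ * Y).det) := by nlinarith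
  exact le_of_mul_le_mul_left h' (by positivity)

lemma prod_le_top {n k : ℕ} (hk : k ≤ n) (μ : Fin n → ℝ) (hμ : Antitone μ) (h0 : ∀ i, 0 ≤ μ i)
    (f : Fin k → Fin n) (hf : Function.Injective f) :
    ∏ i, μ (f i) ≤ ∏ i : Fin k, μ (Fin.castLE hk i) := by
  classical
  have hc : (Finset.univ.image f).card = k := by
    rw [Finset.card_image_of_injective _ hf]; simp
  have e : ∏ i, μ (f i) = ∏ i, μ ((Finset.univ.image f).orderEmbOfFin hc i) := by
    rw [← Finset.prod_image (s := Finset.univ) (g := f) (f := μ) (fun a _ b _ h => hf h),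
      ← Finset.prod_image (s := Finset.univ) (g := (Finset.univ.image f).orderEmbOfFin hc) (f := μ)
      (fun a _ b _ h => (RelEmbedding.injective _) h)]
    congr 1
    ext x
    have := Finset.range_orderEmbOfFin (Finset.univ.image f) hc
    have := Set.ext_iff.1 this x
    simp
  rw [e]
  refine Finset.prod_le_prod (fun i _ => h0 _) fun i _ => hμ ?_
  have hs : StrictMono (fun i : Fin k => ((((Finset.univ.image f).orderEmbOfFin hc i) : Fin n) : ℕ)) :=
    fun a b h => ((Finset.univ.image f).orderEmbOfFin hc).strictMono h
  have key : ∀ m (hm : m < k), m ≤ (((Finset.univ.image f).orderEmbOfFin hc ⟨m, hm⟩ : Fin n) : ℕ) := by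
    intro m
    induction m with
    | zero => intro _; exact Nat.zero_le _
    | succ m ih =>
      intro hm
      have := ih (by omega)
      have h2 := hs (show (⟨m, by omega⟩ : Fin k) < ⟨m+1, hm⟩ by simp)
      simp only at h2
      omega
  exact key i i.2

lemma det_diag_le {n k : ℕ} (hk : k ≤ n) (μ : Fin n → ℝ) (hμ : Antitone μ) (h0 : ∀ i, 0 ≤ μ i)
    (Z : Matrix (Fin n) (Fin k) ℝ) :
    (Zᵀ * (diagonal μ * Z)).det ≤ (∏ i : Fin k, μ (Fin.castLE hk i)) * (Zᵀ * Z).det := by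
  have hkf : (0:ℝ) < k.factorial := by exact_mod_cast k.factorial_pos
  refine le_of_mul_le_mul_left ?_ hkf
  rw [cauchyBinet_sym, mul_left_comm, cauchyBinet_sym, Finset.mul_sum]
  refine Finset.sum_le_sum fun f _ => ?_
  have : (diagonal μ * Z).submatrix f id = Matrix.of fun i j => μ (f i) * (Z.submatrix f id) i j := by
    ext i j; simp [diagonal_mul]
  rw [this, det_mul_column]
  by_cases hf : Function.Injective f
  · have := prod_le_top hk μ hμ h0 f hf
    nlinarith [mul_le_mul_of_nonneg_right this (mul_self_nonneg (Z.submatrix f id).det)]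
  · have : (Z.submatrix f id).det = 0 := by
      simp only [Function.Injective, not_forall] at hf
      obtain ⟨i, j, h, hij⟩ := hf
      exact det_zero_of_row_eq hij (by ext x; simp [h])
    simp [this]

lemma spec_form {n : ℕ} (p : Matrix (Fin n) (Fin n) ℝ) (hp : p.IsHermitian) :
    ∃ U : Matrix (Fin n) (Fin n) ℝ, Uᵀ * U = 1 ∧ U * Uᵀ = 1 ∧ p = U * diagonal (eigs p) * Uᵀ ∧
      ∀ f, mfun p f = U * diagonal (fun i => f (eigs p i)) * Uᵀ := by
  have hU1 := Unitary.coe_star_mul_self hp.eigenvectorUnitary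
  rw [star_eq_conjTranspose, conjTranspose_eq_transpose_of_trivial] at hU1
  have hU2 := mul_eq_one_comm.1 hU1
  refine ⟨hp.eigenvectorUnitary, hU1, hU2, ?_, ?_⟩
  · have := hp.spectral_theorem
    rw [Unitary.conjStarAlgAut_apply, star_eq_conjTranspose,
      conjTranspose_eq_transpose_of_trivial] at this
    simp only [eigs, hp, dif_pos]
    exact this
  · intro f
    simp only [eigs, mfun, hp, dif_pos, IsHermitian.cfc, Unitary.conjStarAlgAut_apply]
    rw [star_eq_conjTranspose, conjTranspose_eq_transpose_of_trivial]
    rfl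

lemma eigs_pos {n : ℕ} {p : Matrix (Fin n) (Fin n) ℝ} (hp : p.PosDef) (i : Fin n) :
    0 < eigs p i := by
  have h := hp.1
  simp only [eigs, h, dif_pos]
  exact hp.eigenvalues_pos i

lemma msqrt_props {n : ℕ} {p : Matrix (Fin n) (Fin n) ℝ} (hp : p.PosDef) :
    (msqrt p)ᵀ = msqrt p ∧ msqrt p * msqrt p = p ∧ IsUnit (msqrt p).det := by
  obtain ⟨U, h1, h2, h3, h4⟩ := spec_form p hp.1
  have hs : msqrt p * msqrt p = p := by
    conv_rhs => rw [h3]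
    rw [msqrt, h4]
    calc _ = U * diagonal (fun i => √(eigs p i)) * (Uᵀ * U) * diagonal (fun i => √(eigs p i)) * Uᵀ := by
          simp only [Matrix.mul_assoc]
      _ = U * (diagonal (fun i => √(eigs p i)) * diagonal (fun i => √(eigs p i))) * Uᵀ := by
          rw [h1, Matrix.mul_one]; simp only [Matrix.mul_assoc]
      _ = _ := by
          rw [diagonal_mul_diagonal]
          simp only [Real.mul_self_sqrt (eigs_pos hp _).le]
  refine ⟨?_, hs, ?_⟩
  · rw [msqrt, h4]; simp [transpose_mul, Matrix.mul_assoc]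
  · have : (msqrt p).det * (msqrt p).det = p.det := by rw [← det_mul, hs]
    have hd := hp.det_pos
    rw [isUnit_iff_ne_zero]
    intro h0
    rw [h0] at this
    simp at this
    linarith

lemma posDef_congr {n k : ℕ} {p : Matrix (Fin n) (Fin n) ℝ} (hp : p.PosDef)
    (W : Matrix (Fin n) (Fin k) ℝ) (hW : Function.Injective W.mulVec) : (Wᵀ * p * W).PosDef := by
  have := hp.conjTranspose_mul_mul_same hW
  rwa [conjTranspose_eq_transpose_of_trivial] at this

lemma inj_of_left {n k : ℕ} (W : Matrix (Fin n) (Fin k) ℝ) (V : Matrix (Fin k) (Fin n) ℝ)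
    (h : V * W = 1) : Function.Injective W.mulVec := by
  intro x y hxy
  have : V *ᵥ (W *ᵥ x) = V *ᵥ (W *ᵥ y) := by
    rw [hxy]
  simpa [h] using this

lemma gmean_form {n : ℕ} {p q : Matrix (Fin n) (Fin n) ℝ} (hp : p.PosDef) (hq : q.PosDef) :
    ∃ (S : Matrix (Fin n) (Fin n) ℝ) (D : Fin n → ℝ), IsUnit S.det ∧ (∀ i, 0 < D i) ∧
      (∀ t, gmean t p q = S * diagonal (fun i => D i ^ t) * Sᵀ) ∧
      gmean 0 p q = p ∧ gmean 1 p q = q := by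
  obtain ⟨hs1, hs2, hs3⟩ := msqrt_props hp
  set s := msqrt p with hs
  have hi1 : s⁻¹ * s = 1 := nonsing_inv_mul _ hs3
  have hi2 : s * s⁻¹ = 1 := mul_nonsing_inv _ hs3
  have hG : (s⁻¹ * q * s⁻¹).PosDef := by
    have := posDef_congr hq s⁻¹ (inj_of_left _ s hi2)
    rwa [transpose_nonsing_inv, hs1] at this
  obtain ⟨U, h1, h2, h3, h4⟩ := spec_form _ hG.1
  set D := eigs (s⁻¹ * q * s⁻¹)
  have hg : ∀ t, gmean t p q = (s * U) * diagonal (fun i => D i ^ t) * (s * U)ᵀ := by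
    intro t
    rw [gmean, ← hs, h4, transpose_mul, hs1]
    simp only [Matrix.mul_assoc]
  refine ⟨s * U, D, ?_, eigs_pos hG, hg, ?_, ?_⟩
  · rw [det_mul]
    refine hs3.mul ?_
    have := congrArg det h1
    rw [det_mul, det_one] at this
    exact IsUnit.of_mul_eq_one_right _ this
  · rw [hg]
    simp only [Real.rpow_zero, diagonal_one, Matrix.mul_one]
    rw [transpose_mul, hs1]
    calc _ = s * (U * Uᵀ) * s := by simp only [Matrix.mul_assoc]
      _ = p := by rw [h2, Matrix.mul_one, hs2]
  · rw [hg]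
    simp only [Real.rpow_one]
    rw [transpose_mul, hs1]
    calc _ = s * (U * diagonal D * Uᵀ) * s := by simp only [Matrix.mul_assoc]
      _ = (s * s⁻¹) * q * (s⁻¹ * s) := by rw [← h3]; simp only [Matrix.mul_assoc]
      _ = q := by rw [hi1, hi2, Matrix.mul_one, Matrix.one_mul]

lemma midpoint_lemma (g : ℝ → ℝ) (C : ℝ) (hb : ∀ t ∈ Set.Icc (0:ℝ) 1, g t ≤ C)
    (hm : ∀ x ∈ Set.Icc (0:ℝ) 1, ∀ y ∈ Set.Icc (0:ℝ) 1, 2 * g ((x + y) / 2) ≤ g x + g y)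
    (t : ℝ) (ht : t ∈ Set.Icc (0:ℝ) 1) : g t ≤ (1 - t) * g 0 + t * g 1 := by
  set h : ℝ → ℝ := fun t => g t - ((1 - t) * g 0 + t * g 1) with hh
  have h0 : h 0 = 0 := by simp [hh]
  have h1 : h 1 = 0 := by simp [hh]
  have hm' : ∀ x ∈ Set.Icc (0:ℝ) 1, ∀ y ∈ Set.Icc (0:ℝ) 1, 2 * h ((x + y) / 2) ≤ h x + h y := by
    intro x hx y hy
    have := hm x hx y hy
    simp only [hh]
    linarith
  have half : ∀ S : ℝ, (∀ t ∈ Set.Icc (0:ℝ) 1, h t ≤ S) → ∀ t ∈ Set.Icc (0:ℝ) 1, h t ≤ S / 2 := by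
    intro S hS t ht
    rcases le_total t (1/2) with hl | hl
    · have := hm' 0 (by simp) (2 * t) ⟨by linarith [ht.1], by linarith⟩
      have h3 := hS (2 * t) ⟨by linarith [ht.1], by linarith⟩
      rw [show (0 + 2 * t) / 2 = t by ring] at this
      linarith
    · have := hm' 1 (by simp) (2 * t - 1) ⟨by linarith, by linarith [ht.2]⟩
      have h3 := hS (2 * t - 1) ⟨by linarith, by linarith [ht.2]⟩
      rw [show (1 + (2 * t - 1)) / 2 = t by ring] at this
      linarith
  have hbd : BddAbove (h '' Set.Icc (0:ℝ) 1) := by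
    refine ⟨C + |g 0| + |g 1|, ?_⟩
    rintro _ ⟨t, ht, rfl⟩
    have := hb t ht
    simp only [hh]
    nlinarith [neg_abs_le (g 0), neg_abs_le (g 1), abs_nonneg (g 0), abs_nonneg (g 1), ht.1, ht.2]
  have hne : (h '' Set.Icc (0:ℝ) 1).Nonempty := ⟨h t, t, ht, rfl⟩
  have hS : ∀ t ∈ Set.Icc (0:ℝ) 1, h t ≤ sSup (h '' Set.Icc (0:ℝ) 1) :=
    fun t ht => le_csSup hbd ⟨t, ht, rfl⟩
  have h2 := half _ hS
  have h3 : sSup (h '' Set.Icc (0:ℝ) 1) ≤ sSup (h '' Set.Icc (0:ℝ) 1) / 2 :=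
    csSup_le hne (by rintro _ ⟨t, ht, rfl⟩; exact h2 t ht)
  have h4 := hS t ht
  have : h t ≤ 0 := by linarith
  simp only [hh] at this
  linarith

/-- Eigenvalues sorted decreasingly. -/
noncomputable def srtEig {n : ℕ} (N : Matrix (Fin n) (Fin n) ℝ) (i : Fin n) : ℝ :=
  eigs N (Tuple.sort (eigs N) i.rev)

lemma srtEig_antitone {n : ℕ} (N : Matrix (Fin n) (Fin n) ℝ) : Antitone (srtEig N) := by
  intro i j hij
  exact Tuple.monotone_sort (eigs N) (Fin.rev_le_rev.2 hij)

lemma sorted_spec {n : ℕ} (N : Matrix (Fin n) (Fin n) ℝ) (hN : N.IsHermitian) :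
    ∃ U : Matrix (Fin n) (Fin n) ℝ, Uᵀ * U = 1 ∧ U * Uᵀ = 1 ∧
      N = U * diagonal (srtEig N) * Uᵀ := by
  obtain ⟨U, h1, h2, h3, -⟩ := spec_form N hN
  let τ : Equiv.Perm (Fin n) := Fin.revPerm.trans (Tuple.sort (eigs N))
  have hτ : ∀ i, srtEig N i = eigs N (τ i) := fun i => rfl
  have e1 : (U.submatrix id τ)ᵀ * (U.submatrix id τ) = 1 := by
    have : (U.submatrix id τ)ᵀ * (U.submatrix id τ) = (Uᵀ * U).submatrix τ τ := by
      ext i j; simp [mul_apply]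
    rw [this, h1, submatrix_one_equiv]
  refine ⟨U.submatrix id τ, e1, mul_eq_one_comm.1 e1, ?_⟩
  conv_lhs => rw [h3]
  ext i j
  rw [mul_apply, mul_apply]
  simp only [mul_diagonal, transpose_apply, submatrix_apply, id, hτ]
  exact (Equiv.sum_comp τ (fun x => U i x * eigs N x * U j x)).symm

/-- The product of the top `k` eigenvalues of `MᵀM`. -/
noncomputable def topProd {n : ℕ} (k : ℕ) (hk : k ≤ n) (M : Matrix (Fin n) (Fin n) ℝ) : ℝ :=
  ∏ i : Fin k, srtEig (Mᵀ * M) (Fin.castLE hk i)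

lemma gram_posDef {n : ℕ} {M : Matrix (Fin n) (Fin n) ℝ} (hM : IsUnit M.det) :
    (Mᵀ * M).PosDef := by
  have := posDef_congr (PosDef.one (n := Fin n) (R := ℝ)) M
    (inj_of_left _ _ (nonsing_inv_mul _ hM))
  simpa using this

lemma topProd_pos {n k : ℕ} (hk : k ≤ n) {M : Matrix (Fin n) (Fin n) ℝ} (hM : IsUnit M.det) :
    0 < topProd k hk M :=
  Finset.prod_pos fun _ _ => eigs_pos (gram_posDef hM) _

lemma sum_fin_filter {n k : ℕ} (hk : k ≤ n) (f : Fin n → ℝ) :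
    ∑ i ∈ Finset.univ.filter (fun i : Fin n => (i : ℕ) < k), f i
      = ∑ i : Fin k, f (Fin.castLE hk i) := by
  symm
  refine Finset.sum_bij (fun i _ => Fin.castLE hk i) ?_ ?_ ?_ ?_
  · intro i _; simp
  · intro i _ j _ h; simpa using h
  · intro i hi
    exact ⟨⟨i, (Finset.mem_filter.1 hi).2⟩, Finset.mem_univ _, rfl⟩
  · intro i _; rfl

lemma sum_log_svals {n k : ℕ} (hk : k ≤ n) {M : Matrix (Fin n) (Fin n) ℝ} (hM : IsUnit M.det) :
    ∑ i ∈ Finset.univ.filter (fun i : Fin n => (i : ℕ) < k), Real.log (svals M i)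
      = Real.log (topProd k hk M) / 2 := by
  have hpos : ∀ i, 0 < srtEig (Mᵀ * M) i := fun i => eigs_pos (gram_posDef hM) _
  rw [sum_fin_filter hk, topProd, Real.log_prod (fun i _ => (hpos _).ne'),
    Finset.sum_div]
  refine Finset.sum_congr rfl fun i _ => ?_
  rw [← Real.log_sqrt (hpos _).le]
  rfl

lemma log_topProd_le {n k : ℕ} (hk : k ≤ n) {M : Matrix (Fin n) (Fin n) ℝ} (hM : IsUnit M.det) :
    Real.log (topProd k hk M) ≤ (Mᵀ * M).trace := by
  have hpos : ∀ i, 0 < srtEig (Mᵀ * M) i := fun i => eigs_pos (gram_posDef hM) _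
  obtain ⟨U, h1, h2, h3⟩ := sorted_spec (Mᵀ * M) (gram_posDef hM).1
  have ht : (Mᵀ * M).trace = ∑ i, srtEig (Mᵀ * M) i := by
    conv_lhs => rw [h3]
    rw [Matrix.mul_assoc, trace_mul_comm, Matrix.mul_assoc, h1, Matrix.mul_one, trace_diagonal]
  rw [ht, topProd, Real.log_prod (fun i _ => (hpos _).ne')]
  calc _ ≤ ∑ i : Fin k, srtEig (Mᵀ * M) (Fin.castLE hk i) :=
        Finset.sum_le_sum fun i _ => (Real.log_le_sub_one_of_pos (hpos _)).trans (by linarith)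
    _ = ∑ i ∈ Finset.univ.filter (fun i : Fin n => (i : ℕ) < k), srtEig (Mᵀ * M) i :=
        (sum_fin_filter hk _).symm
    _ ≤ _ := Finset.sum_le_univ_sum_of_nonneg fun i => (hpos i).le

lemma topProd_upper {n k : ℕ} (hk : k ≤ n) {M : Matrix (Fin n) (Fin n) ℝ} (hM : IsUnit M.det)
    (W : Matrix (Fin n) (Fin k) ℝ) :
    (Wᵀ * (Mᵀ * M) * W).det ≤ topProd k hk M * (Wᵀ * W).det := by
  obtain ⟨U, h1, h2, h3⟩ := sorted_spec (Mᵀ * M) (gram_posDef hM).1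
  have := det_diag_le hk (srtEig (Mᵀ * M)) (srtEig_antitone _)
    (fun i => (eigs_pos (gram_posDef hM) _).le) (Uᵀ * W)
  have e1 : (Uᵀ * W)ᵀ * (diagonal (srtEig (Mᵀ * M)) * (Uᵀ * W)) = Wᵀ * (Mᵀ * M) * W := by
    conv_rhs => rw [h3]
    simp only [transpose_mul, transpose_transpose, Matrix.mul_assoc]
  have e2 : (Uᵀ * W)ᵀ * (Uᵀ * W) = Wᵀ * W := by
    calc _ = Wᵀ * (U * Uᵀ) * W := by
          simp only [transpose_mul, transpose_transpose, Matrix.mul_assoc]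
      _ = _ := by rw [h2, Matrix.mul_one]
  rwa [e1, e2] at this

lemma topProd_attained {n k : ℕ} (hk : k ≤ n) {M : Matrix (Fin n) (Fin n) ℝ} (hM : IsUnit M.det) :
    ∃ (W : Matrix (Fin n) (Fin k) ℝ) (L : Fin k → ℝ), Wᵀ * W = 1 ∧
      (Mᵀ * M) * W = W * diagonal L ∧ ∏ i, L i = topProd k hk M := by
  obtain ⟨U, h1, h2, h3⟩ := sorted_spec (Mᵀ * M) (gram_posDef hM).1
  refine ⟨U.submatrix id (Fin.castLE hk), fun i => srtEig (Mᵀ * M) (Fin.castLE hk i), ?_, ?_, rfl⟩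
  · have : (U.submatrix id (Fin.castLE hk))ᵀ * U.submatrix id (Fin.castLE hk)
        = (Uᵀ * U).submatrix (Fin.castLE hk) (Fin.castLE hk) := by
      ext i j; simp [mul_apply]
    rw [this, h1]
    exact submatrix_one _ (Fin.castLE_injective hk)
  · have e : (Mᵀ * M) * U = U * diagonal (srtEig (Mᵀ * M)) := by
      conv_lhs => rw [h3]
      rw [Matrix.mul_assoc, h1, Matrix.mul_one]
    have e' := congrArg (fun X => X.submatrix id (Fin.castLE hk)) e
    ext i j
    have := congrFun (congrFun e' i) j
    simp only [submatrix_apply, mul_diagonal, id] at this ⊢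
    rw [← this]
    simp [mul_apply]

section pair
variable {n k : ℕ} (hk : k ≤ n) {A P r : Matrix (Fin n) (Fin n) ℝ} (hA : IsUnit A.det)
  (hP : P.PosDef) (hr : r.PosDef)

lemma pair_gram (hP : P.PosDef) (hr : r.PosDef) :
    (msqrt P * A * (msqrt r)⁻¹)ᵀ * (msqrt P * A * (msqrt r)⁻¹)
      = (msqrt r)⁻¹ * (Aᵀ * P * A) * (msqrt r)⁻¹ := by
  obtain ⟨a1, a2, a3⟩ := msqrt_props hP
  obtain ⟨b1, b2, b3⟩ := msqrt_props hr
  simp only [transpose_mul, transpose_nonsing_inv, a1, b1]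
  conv_rhs => rw [← a2]
  simp only [Matrix.mul_assoc]

lemma pair_unit (hA : IsUnit A.det) (hP : P.PosDef) (hr : r.PosDef) :
    IsUnit (msqrt P * A * (msqrt r)⁻¹).det := by
  rw [det_mul, det_mul]
  refine ((msqrt_props hP).2.2.mul hA).mul ?_
  have := (msqrt_props hr).2.2
  rw [← isUnit_iff_isUnit_det] at this ⊢
  simpa using this

lemma pair_upper (hA : IsUnit A.det) (hP : P.PosDef) (hr : r.PosDef)
    (W : Matrix (Fin n) (Fin k) ℝ) :
    (Wᵀ * (Aᵀ * P * A) * W).det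
      ≤ topProd k hk (msqrt P * A * (msqrt r)⁻¹) * (Wᵀ * r * W).det := by
  obtain ⟨b1, b2, b3⟩ := msqrt_props hr
  have h := topProd_upper hk (pair_unit hA hP hr) (msqrt r * W)
  rw [pair_gram hP hr] at h
  have i1 := nonsing_inv_mul _ b3
  have i2 := mul_nonsing_inv _ b3
  have e1 : (msqrt r * W)ᵀ * ((msqrt r)⁻¹ * (Aᵀ * P * A) * (msqrt r)⁻¹) * (msqrt r * W)
      = Wᵀ * (Aᵀ * P * A) * W := by
    calc _ = Wᵀ * (msqrt r * (msqrt r)⁻¹) * (Aᵀ * P * A) * ((msqrt r)⁻¹ * msqrt r) * W := by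
          simp only [transpose_mul, b1, Matrix.mul_assoc]
      _ = _ := by rw [i1, i2, Matrix.mul_one, Matrix.mul_one]
  have e2 : (msqrt r * W)ᵀ * (msqrt r * W) = Wᵀ * r * W := by
    conv_rhs => rw [← b2]
    simp only [transpose_mul, b1, Matrix.mul_assoc]
  rwa [e1, e2] at h

lemma pair_attained (hA : IsUnit A.det) (hP : P.PosDef) (hr : r.PosDef) :
    ∃ (W : Matrix (Fin n) (Fin k) ℝ) (L : Fin k → ℝ), Function.Injective W.mulVec ∧
      (Aᵀ * P * A) * W = r * W * diagonal L ∧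
      ∏ i, L i = topProd k hk (msqrt P * A * (msqrt r)⁻¹) := by
  obtain ⟨b1, b2, b3⟩ := msqrt_props hr
  obtain ⟨W, L, h1, h2, h3⟩ := topProd_attained hk (pair_unit hA hP hr)
  rw [pair_gram hP hr] at h2
  have i1 := nonsing_inv_mul _ b3
  have i2 := mul_nonsing_inv _ b3
  refine ⟨(msqrt r)⁻¹ * W, L, ?_, ?_, h3⟩
  · refine inj_of_left _ (Wᵀ * msqrt r) ?_
    calc _ = Wᵀ * (msqrt r * (msqrt r)⁻¹) * W := by simp only [Matrix.mul_assoc]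
      _ = 1 := by rw [i2, Matrix.mul_one, h1]
  · have := congrArg (fun X => msqrt r * X) h2
    calc _ = (msqrt r * (msqrt r)⁻¹) * (Aᵀ * P * A) * (msqrt r)⁻¹ * W := by
          rw [i2, Matrix.one_mul]; simp only [Matrix.mul_assoc]
      _ = msqrt r * ((msqrt r)⁻¹ * (Aᵀ * P * A) * (msqrt r)⁻¹ * W) := by
          simp only [Matrix.mul_assoc]
      _ = msqrt r * (W * diagonal L) := this
      _ = msqrt r * (msqrt r * (msqrt r)⁻¹) * W * diagonal L := by
          rw [i2, Matrix.mul_one]; simp only [Matrix.mul_assoc]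
      _ = (msqrt r * msqrt r) * ((msqrt r)⁻¹ * W) * diagonal L := by
          simp only [Matrix.mul_assoc]
      _ = _ := by rw [b2]

lemma pair_log_le (hA : IsUnit A.det) (hP : P.PosDef) (hr : r.PosDef) :
    Real.log (topProd k hk (msqrt P * A * (msqrt r)⁻¹)) ≤ (r⁻¹ * (Aᵀ * P * A)).trace := by
  refine (log_topProd_le hk (pair_unit hA hP hr)).trans (le_of_eq ?_)
  rw [pair_gram hP hr, trace_mul_comm, ← Matrix.mul_assoc, ← Matrix.mul_inv_rev,
    (msqrt_props hr).2.1]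

end pair

lemma midpoint_det {n k : ℕ} (hk : k ≤ n) {A P0 Pm P1 r0 rm r1 : Matrix (Fin n) (Fin n) ℝ}
    (hA : IsUnit A.det) (hP0 : P0.PosDef) (hPm : Pm.PosDef) (hP1 : P1.PosDef)
    (hr0 : r0.PosDef) (hrm : rm.PosDef) (hr1 : r1.PosDef)
    (hP : Pm * P0⁻¹ * Pm = P1) (hr : rm * r0⁻¹ * rm = r1) :
    topProd k hk (msqrt Pm * A * (msqrt rm)⁻¹) ^ 2
      ≤ topProd k hk (msqrt P0 * A * (msqrt r0)⁻¹) * topProd k hk (msqrt P1 * A * (msqrt r1)⁻¹) := by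
  obtain ⟨W, L, hW, hL, hprod⟩ := pair_attained hk hA hPm hrm
  obtain ⟨b1, b2, b3⟩ := msqrt_props hP0
  have i2 := mul_nonsing_inv _ b3
  have i1 := nonsing_inv_mul _ b3
  have j2 := mul_nonsing_inv r0 hr0.det_pos.ne'.isUnit
  have j1 := nonsing_inv_mul r0 hr0.det_pos.ne'.isUnit
  have tm : rmᵀ = rm := by
    have := hrm.1.eq; rwa [conjTranspose_eq_transpose_of_trivial] at this
  have t0 : r0ᵀ = r0 := by
    have := hr0.1.eq; rwa [conjTranspose_eq_transpose_of_trivial] at this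
  have tPm : Pmᵀ = Pm := by
    have := hPm.1.eq; rwa [conjTranspose_eq_transpose_of_trivial] at this
  set V := r0⁻¹ * rm * W with hV
  have hVt : Vᵀ = Wᵀ * rm * r0⁻¹ := by
    rw [hV, transpose_mul, transpose_mul, transpose_nonsing_inv, tm, t0]
    simp only [Matrix.mul_assoc]
  set s := msqrt P0
  have cs := det_cs (s * A * V) (s⁻¹ * Pm * A * W)
  have e1 : (s * A * V)ᵀ * (s⁻¹ * Pm * A * W) = (Wᵀ * r1 * W) * diagonal L := by
    calc _ = Vᵀ * (Aᵀ * (s * s⁻¹) * Pm * A * W) := by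
          simp only [transpose_mul, b1, Matrix.mul_assoc]
      _ = Vᵀ * (rm * W * diagonal L) := by rw [i2, Matrix.mul_one, hL]
      _ = Wᵀ * (rm * r0⁻¹ * rm) * W * diagonal L := by
          rw [hVt]; simp only [Matrix.mul_assoc]
      _ = _ := by rw [hr]
  have e2 : (s * A * V)ᵀ * (s * A * V) = Vᵀ * (Aᵀ * P0 * A) * V := by
    rw [← b2]; simp only [transpose_mul, b1, Matrix.mul_assoc]
  have e3 : (s⁻¹ * Pm * A * W)ᵀ * (s⁻¹ * Pm * A * W) = Wᵀ * (Aᵀ * P1 * A) * W := by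
    rw [← hP, ← b2, Matrix.mul_inv_rev]
    simp only [transpose_mul, transpose_nonsing_inv, b1, tPm, Matrix.mul_assoc]
  have e4 : Vᵀ * r0 * V = Wᵀ * r1 * W := by
    calc _ = Wᵀ * rm * (r0⁻¹ * r0) * r0⁻¹ * rm * W := by
          rw [hVt, hV]; simp only [Matrix.mul_assoc]
      _ = Wᵀ * (rm * r0⁻¹ * rm) * W := by
          rw [j1, Matrix.mul_one]; simp only [Matrix.mul_assoc]
      _ = _ := by rw [hr]
  rw [e1, e2, e3, det_mul, det_diagonal, hprod] at cs
  have u0 := pair_upper hk hA hP0 hr0 V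
  have u1 := pair_upper hk hA hP1 hr1 W
  rw [e4] at u0
  have hd : 0 < (Wᵀ * r1 * W).det := (posDef_congr hr1 W hW).det_pos
  have hn : 0 ≤ (Wᵀ * (Aᵀ * P1 * A) * W).det := by
    have h := posDef_congr hP1 A (inj_of_left _ _ (nonsing_inv_mul _ hA))
    exact (posDef_congr h W hW).det_pos.le
  have hp0 := topProd_pos hk (pair_unit hA hP0 hr0)
  have key := cs.trans (mul_le_mul u0 u1 hn (mul_nonneg hp0.le hd.le))
  have hd2 : 0 < (Wᵀ * r1 * W).det ^ 2 := by positivity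
  refine le_of_mul_le_mul_left ?_ hd2
  linarith [key]

lemma curve_posDef {n : ℕ} {S : Matrix (Fin n) (Fin n) ℝ} {D : Fin n → ℝ} (hS : IsUnit S.det)
    (hD : ∀ i, 0 < D i) : (S * diagonal D * Sᵀ).PosDef := by
  have h1 : (diagonal D).PosDef := PosDef.diagonal hD
  have hS' : IsUnit (Sᵀ).det := by rwa [det_transpose]
  have := posDef_congr h1 Sᵀ (inj_of_left _ _ (nonsing_inv_mul _ hS'))
  rwa [transpose_transpose] at this

lemma curve_inv {n : ℕ} {S : Matrix (Fin n) (Fin n) ℝ} {D : Fin n → ℝ} (hS : IsUnit S.det)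
    (hD : ∀ i, 0 < D i) (t : ℝ) : (S * diagonal (fun i => D i ^ t) * Sᵀ)⁻¹
      = (Sᵀ)⁻¹ * diagonal (fun i => D i ^ (-t)) * S⁻¹ := by
  have hS' : IsUnit (Sᵀ).det := by rwa [det_transpose]
  refine inv_eq_right_inv ?_
  calc _ = S * (diagonal (fun i => D i ^ t) * (Sᵀ * (Sᵀ)⁻¹) * diagonal (fun i => D i ^ (-t))) * S⁻¹ := by
        simp only [Matrix.mul_assoc]
    _ = S * S⁻¹ := by
        rw [mul_nonsing_inv _ hS', Matrix.mul_one, diagonal_mul_diagonal]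
        have : (fun i => D i ^ t * D i ^ (-t)) = fun _ => (1:ℝ) := by
          ext i; rw [← Real.rpow_add (hD i)]; simp
        rw [this, diagonal_one, Matrix.mul_one]
    _ = 1 := mul_nonsing_inv _ hS

lemma curve_mid {n : ℕ} {S : Matrix (Fin n) (Fin n) ℝ} {D : Fin n → ℝ} (hS : IsUnit S.det)
    (hD : ∀ i, 0 < D i) (x y : ℝ) :
    (S * diagonal (fun i => D i ^ ((x + y) / 2)) * Sᵀ) * (S * diagonal (fun i => D i ^ x) * Sᵀ)⁻¹
      * (S * diagonal (fun i => D i ^ ((x + y) / 2)) * Sᵀ) = S * diagonal (fun i => D i ^ y) * Sᵀ := by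
  have hS' : IsUnit (Sᵀ).det := by rwa [det_transpose]
  rw [curve_inv hS hD]
  set E := diagonal (fun i => D i ^ ((x + y) / 2))
  calc _ = S * (E * (Sᵀ * (Sᵀ)⁻¹) * diagonal (fun i => D i ^ (-x)) * (S⁻¹ * S) * E) * Sᵀ := by
        simp only [Matrix.mul_assoc]
    _ = _ := by
        rw [mul_nonsing_inv _ hS', nonsing_inv_mul _ hS, Matrix.mul_one, Matrix.mul_one,
          diagonal_mul_diagonal, diagonal_mul_diagonal]
        congr 3
        ext i
        rw [← Real.rpow_add (hD i), ← Real.rpow_add (hD i)]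
        congr 1
        ring

lemma curve_cont {n : ℕ} {D : Fin n → ℝ} (hD : ∀ i, 0 < D i) (S T : Matrix (Fin n) (Fin n) ℝ)
    (c : ℝ) : Continuous (fun t : ℝ => S * diagonal (fun i => D i ^ (c * t)) * T) := by
  have : Continuous (fun t : ℝ => (diagonal (fun i => D i ^ (c * t)) : Matrix (Fin n) (Fin n) ℝ)) := by
    refine Continuous.matrix_diagonal (continuous_pi fun i => ?_)
    exact Continuous.rpow continuous_const (by fun_prop) (fun _ => Or.inl (hD i).ne')
  exact (continuous_const.matrix_mul this).matrix_mul continuous_const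

/-- Geodesic convexity of singular value sums: for every `k ∈ {1,…,n}`,
`∑_{i=1}^k ln α_i((P #_θ Q)^{1/2} A (p #_θ q)^{-1/2})` is bounded by the convex combination. -/
theorem geodesic_convexity_singular_values {n : ℕ}
    (A : Matrix (Fin n) (Fin n) ℝ) (hA : IsUnit A.det)
    (p q P Q : Matrix (Fin n) (Fin n) ℝ)
    (hp : p.PosDef) (hq : q.PosDef) (hP : P.PosDef) (hQ : Q.PosDef)
    (θ : ℝ) (hθ : θ ∈ Set.Icc (0:ℝ) 1) (k : ℕ) (hk1 : 1 ≤ k) (hkn : k ≤ n) :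
    ∑ i ∈ Finset.univ.filter (fun i : Fin n => (i : ℕ) < k),
        Real.log (svals (msqrt (gmean θ P Q) * A * (msqrt (gmean θ p q))⁻¹) i)
      ≤ (1 - θ) * ∑ i ∈ Finset.univ.filter (fun i : Fin n => (i : ℕ) < k),
            Real.log (svals (msqrt P * A * (msqrt p)⁻¹) i)
        + θ * ∑ i ∈ Finset.univ.filter (fun i : Fin n => (i : ℕ) < k),
            Real.log (svals (msqrt Q * A * (msqrt q)⁻¹) i) := by
  obtain ⟨S, D, hS, hD, hg, hg0, hg1⟩ := gmean_form hp hq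
  obtain ⟨T, E, hT, hE, hG, hG0, hG1⟩ := gmean_form hP hQ
  have pr : ∀ t, (gmean t p q).PosDef := fun t => by
    rw [hg]; exact curve_posDef hS fun i => Real.rpow_pos_of_pos (hD i) t
  have pR : ∀ t, (gmean t P Q).PosDef := fun t => by
    rw [hG]; exact curve_posDef hT fun i => Real.rpow_pos_of_pos (hE i) t
  set g : ℝ → ℝ := fun t =>
    Real.log (topProd k hkn (msqrt (gmean t P Q) * A * (msqrt (gmean t p q))⁻¹)) with hgdef
  have hcont : Continuous fun t : ℝ => ((gmean t p q)⁻¹ * (Aᵀ * gmean t P Q * A)).trace := by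
    have c1 : Continuous fun t : ℝ => (gmean t p q)⁻¹ := by
      have := curve_cont hD (Sᵀ)⁻¹ S⁻¹ (-1)
      refine this.congr fun t => ?_
      rw [hg, curve_inv hS hD]
      simp
    have c2 : Continuous fun t : ℝ => gmean t P Q := by
      have := curve_cont hE T Tᵀ 1
      refine this.congr fun t => ?_
      rw [hG]
      simp
    exact (c1.matrix_mul ((continuous_const.matrix_mul c2).matrix_mul continuous_const)).matrix_trace
  obtain ⟨C, hC⟩ := (isCompact_Icc (a := (0:ℝ)) (b := 1)).bddAbove_image hcont.continuousOn
  have hb : ∀ t ∈ Set.Icc (0:ℝ) 1, g t ≤ C := fun t ht =>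
    (pair_log_le hkn hA (pR t) (pr t)).trans (hC ⟨t, ht, rfl⟩)
  have hm : ∀ x ∈ Set.Icc (0:ℝ) 1, ∀ y ∈ Set.Icc (0:ℝ) 1, 2 * g ((x + y) / 2) ≤ g x + g y := by
    intro x _ y _
    have h := midpoint_det hkn hA (pR x) (pR ((x+y)/2)) (pR y) (pr x) (pr ((x+y)/2)) (pr y)
      (by rw [hG, hG, hG]; exact curve_mid hT hE x y) (by rw [hg, hg, hg]; exact curve_mid hS hD x y)
    have px := topProd_pos hkn (pair_unit hA (pR x) (pr x))
    have py := topProd_pos hkn (pair_unit hA (pR y) (pr y))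
    have pm := topProd_pos hkn (pair_unit hA (pR ((x+y)/2)) (pr ((x+y)/2)))
    have h2 := Real.log_le_log (pow_pos pm 2) h
    rw [Real.log_mul px.ne' py.ne', Real.log_pow] at h2
    rw [Nat.cast_ofNat] at h2
    exact h2
  have fin := midpoint_lemma g C hb hm θ hθ
  rw [sum_log_svals hkn (pair_unit hA (pR θ) (pr θ)), sum_log_svals hkn (pair_unit hA hP hp),
    sum_log_svals hkn (pair_unit hA hQ hq)]
  simp only [hgdef, hg0, hg1, hG0, hG1] at fin
  linarith
end
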